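/- arXiv:1009.3990 — 2 statements merged into one kernel-verified Lean document; each statement's English description precedes it below -/
import Mathlib

section
/- Let p be a prime with p ≡ 1 (mod 8), k = ℚ(√p), F the unique quartic subfield of ℚ(μ_p), and ε a unit of the ring of integers of k with ε > 0 and N_{k/ℚ}(ε) = −1. Then the compositum F(p^{1/4}) equals F(√ε), the quadratic extension of F obtained by adjoining a square root of ε. -/
set_option maxHeartbeats 1000000
set_option synthInstance.maxHeartbeats 400000

open NumberField IntermediateField

theorem GaussianInt.exists_eq_mul_sq_of_sq_add_one_eq {p : ℕ} (hp : p.Prime) {a b T U : ℤ}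
    (hb : Even b) (hab : a ^ 2 + b ^ 2 = p) (hT : Even T)
    (hTU : T ^ 2 + 1 = p * U ^ 2) (hdvd : (⟨a, b⟩ : GaussianInt) ∣ ⟨T, 1⟩) :
    ∃ m n : ℤ, b * (m ^ 2 - n ^ 2) + 2 * a * m * n = -T ∧
      U ^ 2 = (m ^ 2 + n ^ 2) ^ 2 := by
  obtain ⟨⟨x, y⟩, hδ⟩ := hdvd
  have h1 : T = a * x - b * y := by
    have := congrArg Zsqrtd.re hδ
    simp at this; linarith
  have h2 : 1 = a * y + b * x := by
    have := congrArg Zsqrtd.im hδ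
    simpa using this
  have hp0 : (p : ℤ) ≠ 0 := by exact_mod_cast hp.ne_zero
  have hN : x ^ 2 + y ^ 2 = U ^ 2 := by
    apply mul_left_cancel₀ hp0
    rw [← hTU, ← hab, h1]
    linear_combination (-(a * y + b * x) - 1) * h2
  obtain ⟨t, ht⟩ := hT.exists_two_nsmul
  have hcop0 : IsCoprime (⟨T, 1⟩ : GaussianInt) ⟨T, -1⟩ := by
    refine ⟨⟨T, -1⟩ + ⟨t ^ 2, 0⟩ * ⟨0, 2⟩, -⟨t ^ 2, 0⟩ * ⟨0, 2⟩, ?_⟩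
    have ht' : T = 2 * t := by simpa using ht
    subst ht'
    ext <;> simp <;> ring
  have hcop : IsCoprime (⟨x, y⟩ : GaussianInt) ⟨x, -y⟩ := by
    refine IsCoprime.of_isCoprime_of_dvd_left (IsCoprime.of_isCoprime_of_dvd_right hcop0 ?_) ?_
    · refine ⟨⟨a, -b⟩, ?_⟩
      ext <;> simp <;> linarith
    · refine ⟨⟨a, b⟩, ?_⟩
      ext <;> simp <;> linarith
  obtain ⟨⟨m, n⟩, u, hu⟩ := exists_associated_pow_of_mul_eq_pow' (R := GaussianInt)
    (c := ⟨U, 0⟩) (k := 2) hcop (by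
      rw [sq]
      ext <;> simp <;> linarith)
  obtain ⟨v, hv⟩ : ∃ v : GaussianInt, v = u := ⟨_, rfl⟩
  have hnorm : v.norm = 1 := by
    rw [hv]; exact (Zsqrtd.norm_eq_one_iff' (by norm_num) _).2 u.isUnit
  rw [← hv] at hu
  obtain ⟨c, d⟩ := v
  have hcd : c ^ 2 + d ^ 2 = 1 := by
    simp [Zsqrtd.norm] at hnorm; linarith
  have h3 : x = (m ^ 2 - n ^ 2) * c - 2 * m * n * d := by
    have := congrArg Zsqrtd.re hu
    simp [sq] at this; linarith
  have h4 : y = (m ^ 2 - n ^ 2) * d + 2 * m * n * c := by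
    have := congrArg Zsqrtd.im hu
    simp [sq] at this; linarith
  have hU : U ^ 2 = (m ^ 2 + n ^ 2) ^ 2 := by
    rw [← hN, h3, h4]
    linear_combination (m ^ 2 + n ^ 2) ^ 2 * hcd
  have hcases : c = 0 ∧ (d = 1 ∨ d = -1) ∨ d = 0 := by
    have hc : -1 ≤ c ∧ c ≤ 1 := by constructor <;> nlinarith
    have hd : -1 ≤ d ∧ d ≤ 1 := by constructor <;> nlinarith
    obtain ⟨hc1, hc2⟩ := hc
    obtain ⟨hd1, hd2⟩ := hd
    interval_cases c <;> interval_cases d <;> omega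
  obtain ⟨b', rfl⟩ := hb
  rcases hcases with ⟨rfl, rfl | rfl⟩ | rfl
  · exact ⟨m, n, by rw [h1, h3, h4]; ring, hU⟩
  · exact ⟨-n, m, by rw [h1, h3, h4]; ring, by rw [hU]; ring⟩
  · exfalso
    rw [h4] at h2
    have : (2 : ℤ) ∣ 1 := ⟨a * m * n * c + b' * x, by linear_combination h2⟩
    omega

theorem exists_two_mul_add_mul_eq_sq {p : ℕ} (hp : p.Prime) {a b T U : ℤ}
    (hb : Even b) (hab : a ^ 2 + b ^ 2 = p) (hT : Even T) (hU : 0 < U)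
    (hTU : T ^ 2 + 1 = p * U ^ 2) {R : Type*} [CommRing R] {s : R} (hs : s ^ 2 = p) :
    ∃ m n : ℤ, 2 * (s + a) * (T + U * s) = (m + n * s) ^ 2 := by
  have key : ∃ b' : ℤ, Even b' ∧ a ^ 2 + b' ^ 2 = p ∧ (⟨a, b'⟩ : GaussianInt) ∣ ⟨T, 1⟩ := by
    have hirr : Irreducible (⟨a, b⟩ : GaussianInt) := by
      have h : (⟨a, b⟩ : GaussianInt).norm = p := by
        simp [Zsqrtd.norm]; linarith
      refine ⟨fun hu => ?_, fun {x y} hxy => ?_⟩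
      · rw [← Zsqrtd.norm_eq_one_iff, h] at hu
        simp at hu
        exact hp.one_lt.ne' hu
      · rw [hxy, Zsqrtd.norm_mul] at h
        have h' := congrArg Int.natAbs h
        rw [Int.natAbs_mul, Int.natAbs_natCast] at h'
        rw [← Zsqrtd.norm_eq_one_iff, ← Zsqrtd.norm_eq_one_iff]
        rw [← h'] at hp
        rcases Nat.prime_mul_iff.1 hp with h | h
        · exact Or.inr h.2
        · exact Or.inl h.2
    have hd : (⟨a, b⟩ : GaussianInt) ∣ ⟨T, 1⟩ * ⟨T, -1⟩ := by
      refine ⟨⟨a, -b⟩ * ⟨U ^ 2, 0⟩, ?_⟩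
      ext
      · simp; linear_combination hTU - U ^ 2 * hab
      · simp; ring
    rcases hirr.prime.dvd_or_dvd hd with h | ⟨⟨x, y⟩, h⟩
    · exact ⟨b, hb, hab, h⟩
    · refine ⟨-b, hb.neg, by rw [neg_sq, hab], ⟨x, -y⟩, ?_⟩
      have h1 := congrArg Zsqrtd.re h
      have h2 := congrArg Zsqrtd.im h
      simp at h1 h2
      ext <;> simp <;> linarith
  obtain ⟨b', hb', hab', hdvd⟩ := key
  obtain ⟨m, n, h2, h3⟩ :=
    GaussianInt.exists_eq_mul_sq_of_sq_add_one_eq hp hb' hab' hT hTU hdvd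
  have h4 : U = m ^ 2 + n ^ 2 := by
    rcases sq_eq_sq_iff_eq_or_eq_neg.1 h3 with h | h <;> nlinarith
  refine ⟨a * m - b' * n - a * n - b' * m, m - n, ?_⟩
  have e2 := congrArg (Int.cast : ℤ → R) h2
  have e3 := congrArg (Int.cast : ℤ → R) hab'
  subst h4
  push_cast at e2 e3 ⊢
  rw [← hs] at e3
  linear_combination 2 * (s + a) * e2 - (m + n) ^ 2 * e3

theorem Int.exists_sq_eq_of_odd {u : ℤ} (hu : Odd u) : ∃ v : ℤ, u ^ 2 = 8 * v + 1 := by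
  obtain ⟨v, hv⟩ := Int.eight_dvd_sq_sub_one_of_odd hu
  exact ⟨v, by linarith⟩

theorem exists_even_of_mul_sq_eq_sq_add_four {p : ℕ} (hp : p.Prime) (hp8 : p % 8 = 1) {s : ℤ} {y : ℚ}
    (hy : 0 < y) (h : p * y ^ 2 = s ^ 2 + 4) :
    ∃ T U : ℤ, s = 2 * T ∧ y = 2 * U ∧ 0 < U ∧ Even T ∧ T ^ 2 + 1 = p * U ^ 2 := by
  have hden : y.den = 1 := by
    have h1 : (p : ℤ) * y.num ^ 2 = y.den ^ 2 * (s ^ 2 + 4) := by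
      have hd : (y.den : ℚ) ≠ 0 := by exact_mod_cast y.den_ne_zero
      rw [← Rat.num_div_den y] at h
      field_simp at h
      exact_mod_cast h
    have h2 : (y.den : ℤ) ^ 2 ∣ p := by
      refine IsCoprime.dvd_of_dvd_mul_right (z := y.num ^ 2) ?_ ⟨_, h1⟩
      exact ((Int.isCoprime_iff_gcd_eq_one.2 (by simpa [Int.gcd] using y.reduced)).symm).pow
    have h3 : y.den * y.den ∣ p := by rw [← sq]; exact_mod_cast h2
    exact Nat.isUnit_iff.1 (hp.prime.irreducible.squarefree _ h3)
  obtain ⟨u, rfl⟩ : ∃ u : ℤ, y = u := ⟨y.num, (Rat.den_eq_one_iff y).1 hden |>.symm⟩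
  replace h : (p : ℤ) * u ^ 2 = s ^ 2 + 4 := by exact_mod_cast h
  replace hy : 0 < u := by exact_mod_cast hy
  obtain ⟨q, hq⟩ : ∃ q : ℤ, (p : ℤ) = 8 * q + 1 := ⟨p / 8, by omega⟩
  rw [hq] at h
  have hs : Even s := by
    by_contra hs
    rw [Int.not_even_iff_odd] at hs
    have hu : Odd u := by
      by_contra hu
      rw [Int.not_odd_iff_even] at hu
      obtain ⟨v, rfl⟩ := hu
      obtain ⟨t, rfl⟩ := hs
      ring_nf at h
      omega
    obtain ⟨l, hl⟩ := Int.exists_sq_eq_of_odd hs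
    obtain ⟨v, hv⟩ := Int.exists_sq_eq_of_odd hu
    rw [hl, hv] at h
    ring_nf at h
    omega
  obtain ⟨T, rfl⟩ := hs
  have hu : Even u := by
    by_contra hu
    rw [Int.not_even_iff_odd] at hu
    obtain ⟨v, hv⟩ := Int.exists_sq_eq_of_odd hu
    rw [hv] at h
    ring_nf at h
    omega
  obtain ⟨U, rfl⟩ := hu
  have h5 : T ^ 2 + 1 = (8 * q + 1) * U ^ 2 := by linarith
  refine ⟨T, U, by ring, by push_cast; ring, by omega, ?_, by rw [hq]; exact h5⟩
  by_contra hT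
  rw [Int.not_even_iff_odd] at hT
  obtain ⟨l, hl⟩ := Int.exists_sq_eq_of_odd hT
  rw [hl] at h5
  rcases Int.even_or_odd U with ⟨v, rfl⟩ | hU
  · ring_nf at h5
    omega
  · obtain ⟨v, hv⟩ := Int.exists_sq_eq_of_odd hU
    rw [hv] at h5
    ring_nf at h5
    omega

theorem Algebra.sq_sub_trace_mul_add_norm_eq_zero {K L : Type*} [Field K] [CommRing L]
    [Algebra K L] (h : Module.finrank K L = 2) (x : L) :
    x ^ 2 - algebraMap K L (Algebra.trace K L x) * x + algebraMap K L (Algebra.norm K x) = 0 := by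
  have : FiniteDimensional K L := FiniteDimensional.of_finrank_pos (by omega)
  let b : Module.Basis (Fin 2) K L := Module.finBasisOfFinrankEq K L h
  have hM := Matrix.aeval_self_charpoly (Algebra.leftMulMatrix b x)
  rw [Matrix.charpoly_fin_two, ← Algebra.trace_eq_matrix_trace, ← Algebra.norm_eq_matrix_det] at hM
  apply Algebra.leftMulMatrix_injective b
  rw [map_zero, ← hM]
  simp [Algebra.algebraMap_eq_smul_one]

theorem Nat.Prime.ratCast_sq_ne {p : ℕ} (hp : p.Prime) (x : ℚ) : x ^ 2 ≠ p := by
  intro h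
  have : IsSquare (p : ℚ) := ⟨x, by rw [← h, sq]⟩
  rw [Rat.isSquare_natCast_iff] at this
  exact hp.prime.irreducible.not_isSquare this

theorem finrank_adjoin_sqrt_eq_two {p : ℕ} (hp : p.Prime) {s : ℂ} (hs : s ^ 2 = p) :
    Module.finrank ℚ ℚ⟮s⟯ = 2 := by
  have hmonic : (Polynomial.X ^ 2 - Polynomial.C (p : ℚ)).Monic :=
    Polynomial.monic_X_pow_sub_C _ two_ne_zero
  have hroot : Polynomial.aeval s (Polynomial.X ^ 2 - Polynomial.C (p : ℚ)) = 0 := by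
    simp [hs]
  have hint : IsIntegral ℚ s := ⟨_, hmonic, hroot⟩
  rw [IntermediateField.adjoin.finrank hint]
  apply le_antisymm
  · refine (Polynomial.natDegree_le_of_dvd (minpoly.dvd ℚ s hroot) hmonic.ne_zero).trans ?_
    rw [Polynomial.natDegree_X_pow_sub_C]
  · rw [minpoly.two_le_natDegree_iff hint]
    rintro ⟨x, rfl⟩
    apply hp.ratCast_sq_ne x
    rw [eq_ratCast] at hs
    exact_mod_cast hs

theorem exists_eq_add_mul_of_mem_adjoin_sqrt {p : ℕ} {s : ℂ} (hs : s ^ 2 = p) {z : ℂ}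
    (hz : z ∈ ℚ⟮s⟯) : ∃ x y : ℚ, z = x + y * s := by
  have hint : IsIntegral ℚ s :=
    ⟨Polynomial.X ^ 2 - Polynomial.C (p : ℚ), Polynomial.monic_X_pow_sub_C _ two_ne_zero,
      by simp [hs]⟩
  rw [← IntermediateField.mem_toSubalgebra,
    IntermediateField.adjoin_simple_toSubalgebra_of_isAlgebraic hint.isAlgebraic] at hz
  induction hz using Algebra.adjoin_induction with
  | mem x hx => exact ⟨0, 1, by simp_all⟩
  | algebraMap r => exact ⟨r, 0, by simp⟩
  | add u v _ _ hu hv =>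
    obtain ⟨x, y, rfl⟩ := hu
    obtain ⟨x', y', rfl⟩ := hv
    exact ⟨x + x', y + y', by push_cast; ring⟩
  | mul u v _ _ hu hv =>
    obtain ⟨x, y, rfl⟩ := hu
    obtain ⟨x', y', rfl⟩ := hv
    exact ⟨x * x' + p * y * y', x * y' + y * x', by push_cast; rw [← hs]; ring⟩

theorem exists_unit_eq_add_mul_sqrt {p : ℕ} (hp : p.Prime) (hp8 : p % 8 = 1)
    {k : IntermediateField ℚ ℂ} (hk : k = ℚ⟮(Real.sqrt p : ℂ)⟯) [NumberField k] {ε : 𝓞 k}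
    (hεpos : ∃ r : ℝ, 0 < r ∧ ((ε : k) : ℂ) = r) (hεnorm : Algebra.norm ℚ (ε : k) = -1) :
    ∃ T U : ℤ, 0 < U ∧ Even T ∧ T ^ 2 + 1 = p * U ^ 2 ∧
      ((ε : k) : ℂ) = T + U * (Real.sqrt p : ℂ) := by
  have hsR : Real.sqrt p ^ 2 = p := Real.sq_sqrt (by positivity)
  have hs : (Real.sqrt p : ℂ) ^ 2 = p := by exact_mod_cast hsR
  have hspos : 0 < Real.sqrt p := Real.sqrt_pos.2 (by exact_mod_cast hp.pos)
  have hrank : Module.finrank ℚ k = 2 := by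
    rw [hk]; exact finrank_adjoin_sqrt_eq_two hp hs
  obtain ⟨r, hr, hεr⟩ := hεpos
  obtain ⟨t, ht⟩ := IsIntegrallyClosed.isIntegral_iff.1
    (Algebra.isIntegral_trace (L := ℚ) (RingOfIntegers.isIntegral_coe ε))
  have hquad : r ^ 2 - t * r - 1 = 0 := by
    have := Algebra.sq_sub_trace_mul_add_norm_eq_zero hrank (ε : k)
    rw [hεnorm, ← ht] at this
    have := congrArg (algebraMap k ℂ) this
    simp at this
    change ((ε : k) : ℂ) ^ 2 - t * ((ε : k) : ℂ) + -1 = 0 at this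
    rw [hεr] at this
    have : ((r ^ 2 - t * r + -1 : ℝ) : ℂ) = 0 := by push_cast; exact this
    rw [Complex.ofReal_eq_zero] at this
    linarith
  obtain ⟨x, y, hxy⟩ := exists_eq_add_mul_of_mem_adjoin_sqrt hs
    (z := ((ε : k) : ℂ)) (by rw [← hk]; exact (ε : k).2)
  rw [hεr] at hxy
  replace hxy : r = x + y * Real.sqrt p := by exact_mod_cast hxy
  have hirr : ∀ u v : ℚ, u + v * Real.sqrt p = 0 → u = 0 ∧ v = 0 := by
    intro u v huv
    have hv : v = 0 := by
      by_contra hv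
      apply hp.ratCast_sq_ne (-u / v)
      have hv' : (v : ℝ) ≠ 0 := by exact_mod_cast hv
      have : Real.sqrt p = -u / v := by field_simp; linarith
      rw [this] at hsR
      exact_mod_cast hsR
    subst hv
    simp at huv
    exact ⟨huv, rfl⟩
  obtain ⟨h1, h2⟩ := hirr (x ^ 2 + p * y ^ 2 - t * x - 1) (2 * x * y - t * y) (by
    push_cast
    rw [hxy] at hquad
    linear_combination hquad - y ^ 2 * hsR)
  have hy0 : y ≠ 0 := by
    rintro rfl
    have hε' : (ε : k) = algebraMap ℚ k x := by
      apply Subtype.ext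
      change ((ε : k) : ℂ) = algebraMap ℚ ℂ x
      rw [hεr, hxy]
      simp
    rw [hε', Algebra.norm_algebraMap, hrank] at hεnorm
    nlinarith
  have hx : t = 2 * x := by
    apply mul_right_cancel₀ hy0; linarith
  have hy : 0 < 2 * y := by
    have h3 : (2 * x : ℝ) = t := by exact_mod_cast hx.symm
    have h4 : r * (2 * y * Real.sqrt p - r) = 1 := by
      have : 2 * y * Real.sqrt p = 2 * r - t := by rw [← h3, hxy]; ring
      rw [this]; linarith
    have h5 : 0 < 2 * y * Real.sqrt p - r := by
      by_contra! h
      nlinarith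
    have h6 : 0 < 2 * y * Real.sqrt p := by linarith
    exact_mod_cast (pos_iff_pos_of_mul_pos h6).2 hspos
  obtain ⟨T, U, hT, hU, hU0, hTe, hTU⟩ := exists_even_of_mul_sq_eq_sq_add_four hp hp8 (s := t) hy (by
    rw [hx] at h1 ⊢; linarith)
  refine ⟨T, U, hU0, hTe, hTU, ?_⟩
  have hxT : x = T := by rw [hT] at hx; push_cast at hx; linarith
  have hyU : y = U := by linarith
  rw [hεr, hxy, hxT, hyU]
  push_cast
  rfl

theorem ZMod.exists_pow_four_eq {p m : ℕ} [Fact p.Prime] (hm : p - 1 = 4 * m) {u : (ZMod p)ˣ}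
    (hu : u ^ m = 1) : ∃ v, v ^ 4 = u := by
  obtain ⟨g, hg⟩ := IsCyclic.exists_generator (α := (ZMod p)ˣ)
  have hord : orderOf g = 4 * m := by
    rw [orderOf_eq_card_of_forall_mem_zpowers hg, Nat.card_eq_fintype_card,
      ZMod.card_units_eq_totient, Nat.totient_prime Fact.out, hm]
  obtain ⟨j, rfl⟩ := Subgroup.mem_zpowers_iff.1 (hg u)
  have hm0 : 0 < m := by
    have := (Fact.out : p.Prime).two_le
    omega
  rw [← zpow_natCast, ← zpow_mul, ← orderOf_dvd_iff_zpow_eq_one, hord] at hu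
  push_cast at hu
  obtain ⟨i, rfl⟩ := Int.dvd_of_mul_dvd_mul_right (by omega) hu
  exact ⟨g ^ i, by rw [← zpow_natCast, ← zpow_mul, mul_comm]; rfl⟩

theorem mem_of_eq_sum_of_pow_invariant {p m : ℕ} (hp : p.Prime) (hm : p - 1 = 4 * m)
    {K Ω : Type*} [Field K] [Field Ω] [Algebra K Ω] {ζ : Ω} (hζ : IsPrimitiveRoot ζ p)
    (hrank : Module.finrank K K⟮ζ⟯ = p - 1) {F : IntermediateField K Ω} (hFle : F ≤ K⟮ζ⟯)
    (hF4 : Module.finrank K F = 4) [NeZero p] (f : ZMod p → ℤ)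
    (hf : ∀ (v : (ZMod p)ˣ) (x : ZMod p), f (v ^ 4 * x) = f x) :
    ∑ x, (f x : Ω) * ζ ^ x.val ∈ F := by
  have : Fact p.Prime := ⟨hp⟩
  have hcyc : IsCyclotomicExtension {p} K K⟮ζ⟯ := by
    change IsCyclotomicExtension {p} K (IntermediateField.adjoin K {ζ}).toSubalgebra
    rw [IntermediateField.adjoin_simple_toSubalgebra_of_isAlgebraic
      (hζ.isIntegral hp.pos).tower_top.isAlgebraic]
    exact hζ.adjoin_isCyclotomicExtension K
  have hgal : IsGalois K K⟮ζ⟯ := IsCyclotomicExtension.isGalois {p} K _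
  have hfin : FiniteDimensional K K⟮ζ⟯ := IsCyclotomicExtension.finiteDimensional {p} K _
  let z : K⟮ζ⟯ := ⟨ζ, IntermediateField.mem_adjoin_simple_self K ζ⟩
  have hz : IsPrimitiveRoot z p := (IsPrimitiveRoot.coe_submonoidClass_iff (M := Ω)).1 hζ
  let θ : K⟮ζ⟯ := ∑ x, (f x : K⟮ζ⟯) * z ^ x.val
  have hθ : (θ : Ω) = ∑ x, (f x : Ω) * ζ ^ x.val := by
    simp [θ, z]
  let E := IntermediateField.restrict hFle
  have hE4 : Module.finrank K E = 4 := by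
    rw [← hF4]
    exact (IntermediateField.restrictAlgEquiv hFle).toLinearEquiv.finrank_eq.symm
  have hcard : Nat.card E.fixingSubgroup = m := by
    rw [IsGalois.card_fixingSubgroup_eq_finrank]
    have h1 := Module.finrank_mul_finrank K E K⟮ζ⟯
    rw [hE4, hrank, hm] at h1
    omega
  suffices θ ∈ E by
    rw [← hθ]
    exact (IntermediateField.mem_restrict hFle θ).1 this
  rw [← IsGalois.fixedField_fixingSubgroup E, IntermediateField.mem_fixedField_iff]
  intro σ hσ
  have hσm : σ ^ m = 1 := by
    have := pow_card_eq_one' (x := (⟨σ, hσ⟩ : E.fixingSubgroup))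
    rw [hcard] at this
    exact congrArg Subtype.val this
  obtain ⟨v, hv⟩ := ZMod.exists_pow_four_eq hm (u := hz.autToPow K σ)
    (by rw [← map_pow, hσm, map_one])
  have hσz : σ z = AddChar.zmodChar p hz.pow_eq_one ((v ^ 4 : (ZMod p)ˣ) : ZMod p) := by
    rw [hv, AddChar.zmodChar_apply, hz.autToPow_spec K]
  have hθψ : θ = ∑ x, (f x : K⟮ζ⟯) * AddChar.zmodChar p hz.pow_eq_one x := rfl
  rw [hθψ, map_sum]
  refine Fintype.sum_equiv (Units.mulLeft (v ^ 4)) _ _ fun x => ?_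
  rw [map_mul, map_intCast, Units.mulLeft_apply, Units.val_pow_eq_pow_val, hf,
    AddChar.zmodChar_apply, map_pow, hσz, ← AddChar.map_nsmul_eq_pow, nsmul_eq_mul,
    ZMod.natCast_zmod_val, Units.val_pow_eq_pow_val, mul_comm x]

theorem exists_int_add_int_mul_I_of_mem_adjoin {z : ℂ} (hz : z ∈ Algebra.adjoin ℤ {Complex.I}) :
    ∃ c d : ℤ, z = c + d * Complex.I := by
  induction hz using Algebra.adjoin_induction with
  | mem x hx => exact ⟨0, 1, by simp_all⟩
  | algebraMap r => exact ⟨r, 0, by simp⟩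
  | add u v _ _ hu hv =>
    obtain ⟨x, y, rfl⟩ := hu
    obtain ⟨x', y', rfl⟩ := hv
    exact ⟨x + x', y + y', by push_cast; ring⟩
  | mul u v _ _ hu hv =>
    obtain ⟨x, y, rfl⟩ := hu
    obtain ⟨x', y', rfl⟩ := hv
    exact ⟨x * x' - y * y', x * y' + y * x', by
      push_cast; linear_combination (y * y' : ℂ) * Complex.I_sq⟩

theorem exists_int_eq_add_inv_of_pow_four {w : ℂ} (hw : w = 0 ∨ w ^ 4 = 1) :
    ∃ n : ℤ, (n : ℂ) = w + w⁻¹ := by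
  rcases hw with rfl | hw
  · exact ⟨0, by simp⟩
  · have h : (w - 1) * (w + 1) * ((w - Complex.I) * (w + Complex.I)) = 0 := by
      linear_combination hw - (w ^ 2 - 1) * Complex.I_sq
    rcases mul_eq_zero.1 h with h | h <;> rcases mul_eq_zero.1 h with h | h
    · exact ⟨2, by rw [sub_eq_zero.1 h]; norm_num⟩
    · exact ⟨-2, by rw [eq_neg_of_add_eq_zero_left h]; norm_num⟩
    · exact ⟨0, by rw [sub_eq_zero.1 h]; simp⟩
    · exact ⟨0, by rw [eq_neg_of_add_eq_zero_left h]; simp⟩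

theorem exists_sqrt_mem_quartic {p : ℕ} (hp : p.Prime) (hp8 : p % 8 = 1) {ζ : ℂ}
    (hζ : IsPrimitiveRoot ζ p) {F : IntermediateField ℚ ℂ} (hFle : F ≤ ℚ⟮ζ⟯)
    (hF4 : Module.finrank ℚ F = 4) :
    ∃ (a b : ℤ) (g θ : ℂ), Odd a ∧ Even b ∧ a ^ 2 + b ^ 2 = p ∧ g ^ 2 = p ∧
      θ ^ 2 = 2 * g * a + 2 * p ∧ θ ∈ F := by
  have : Fact p.Prime := ⟨hp⟩
  obtain ⟨m, hm⟩ : ∃ m, p - 1 = 4 * m := ⟨(p - 1) / 4, by omega⟩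
  have hcard : 4 ∣ Fintype.card (ZMod p) - 1 := by rw [ZMod.card]; exact ⟨m, hm⟩
  have hI : IsPrimitiveRoot Complex.I 4 := Complex.isPrimitiveRoot_I
  obtain ⟨χ, hχ⟩ := MulChar.exists_mulChar_orderOf (ZMod p) hcard hI
  have hχ4 : χ ^ 4 = 1 := hχ ▸ pow_orderOf_eq_one χ
  have hχ2 : χ * χ ≠ 1 := by
    rw [← sq]
    intro h
    have := orderOf_dvd_of_pow_eq_one h
    rw [hχ] at this
    omega
  have hχ1 : χ ≠ 1 := fun h => hχ2 (by rw [h, one_mul])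
  have hχinv : χ⁻¹ * χ⁻¹ = χ * χ := by
    rw [← mul_inv, inv_eq_iff_mul_eq_one, ← hχ4]
    rw [← sq, ← sq, ← pow_mul]
  have hval : ∀ x : ZMod p, χ x = 0 ∨ χ x ^ 4 = 1 := by
    intro x
    by_cases hx : IsUnit x
    · right
      rw [← MulChar.pow_apply' χ four_ne_zero, hχ4, MulChar.one_apply hx]
    · exact Or.inl (χ.map_nonunit hx)
  have hv4 : ∀ v : (ZMod p)ˣ, χ (v : ZMod p) ^ 4 = 1 := fun v =>
    (hval v).resolve_left (v.isUnit.map χ).ne_zero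
  let ψ : AddChar (ZMod p) ℂ := AddChar.zmodChar p hζ.pow_eq_one
  have hψ : ψ.IsPrimitive := AddChar.zmodChar_primitive_of_primitive_root p hζ
  have hneg : χ (-1) = 1 := by
    obtain ⟨v, hv⟩ := ZMod.exists_pow_four_eq hm (u := -1) (by
      apply Even.neg_one_pow
      exact ⟨p / 8, by omega⟩)
    have := hv4 v
    rw [← map_pow, ← Units.val_pow_eq_pow_val, hv] at this
    simpa using this
  obtain ⟨z, hz, hJ⟩ := exists_jacobiSum_eq_neg_one_add (by norm_num) hχ4 hχ4 hcard hI
  obtain ⟨c, d, rfl⟩ := exists_int_add_int_mul_I_of_mem_adjoin hz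
  let a : ℤ := -1 + 2 * d
  let b : ℤ := -2 * c
  have hJ' : jacobiSum χ χ = a + b * Complex.I := by
    rw [hJ]
    simp only [a, b]
    push_cast
    linear_combination (c + d * Complex.I - 2 * d) * Complex.I_sq
  have hJinv : jacobiSum χ⁻¹ χ⁻¹ = a - b * Complex.I := by
    have h : jacobiSum χ⁻¹ χ⁻¹ = star (jacobiSum χ χ) := by
      simp only [jacobiSum, star_sum, star_mul', MulChar.star_apply']
    rw [h, hJ']
    simp [sub_eq_add_neg]
  let g := gaussSum (χ * χ) ψ
  let G := gaussSum χ ψ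
  let G' := gaussSum χ⁻¹ ψ
  have hGG : G * G' = p := by
    have h1 := gaussSum_mul_gaussSum_eq_card hχ1 hψ
    have h2 := mul_gaussSum_inv_eq_gaussSum χ⁻¹ ψ
    rw [MulChar.inv_apply', inv_neg, inv_one, hneg, one_mul] at h2
    rw [h2, ZMod.card] at h1
    exact h1
  have hG : g * (a + b * Complex.I) = G ^ 2 := by
    rw [← hJ', sq]; exact jacobiSum_mul_nontrivial hχ2 ψ
  have hG' : g * (a - b * Complex.I) = G' ^ 2 := by
    rw [← hJinv, sq]
    have := jacobiSum_mul_nontrivial (χ := χ⁻¹) (φ := χ⁻¹) (by rwa [hχinv]) ψ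
    rwa [hχinv] at this
  have hpC : (p : ℂ) ≠ 0 := by exact_mod_cast hp.ne_zero
  have hg : g ^ 2 = p := by
    have h1 := gaussSum_mul_gaussSum_eq_card hχ2 hψ
    have h2 := mul_gaussSum_inv_eq_gaussSum (χ * χ)⁻¹ ψ
    rw [MulChar.inv_apply', inv_neg, inv_one, MulChar.mul_apply, hneg, one_mul, one_mul] at h2
    rw [h2, ZMod.card, mul_inv, hχinv, ← sq] at h1
    exact h1
  have hab : (a ^ 2 + b ^ 2 : ℂ) = p := by
    apply mul_left_cancel₀ hpC
    have : (g * (a + b * Complex.I)) * (g * (a - b * Complex.I)) = p ^ 2 := by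
      rw [hG, hG', ← mul_pow, hGG]
    linear_combination this - (a ^ 2 + b ^ 2) * hg + (g ^ 2 * b ^ 2) * Complex.I_sq
  choose f hf using fun x => exists_int_eq_add_inv_of_pow_four (hval x)
  refine ⟨a, b, g, G + G', ⟨d - 1, by simp only [a]; ring⟩, ⟨-c, by simp only [b]; ring⟩,
    by exact_mod_cast hab, hg, by linear_combination 2 * hGG - hG - hG', ?_⟩
  have hsum : G + G' = ∑ x, (f x : ℂ) * ζ ^ x.val := by
    simp only [G, G', gaussSum, ← Finset.sum_add_distrib]
    refine Finset.sum_congr rfl fun x _ => ?_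
    rw [hf, MulChar.inv_apply_eq_inv', ← add_mul]
    rfl
  rw [hsum]
  have hrank : Module.finrank ℚ ℚ⟮ζ⟯ = p - 1 := by
    rw [IntermediateField.adjoin.finrank (hζ.isIntegral hp.pos).tower_top,
      ← Polynomial.cyclotomic_eq_minpoly_rat hζ hp.pos, Polynomial.natDegree_cyclotomic,
      Nat.totient_prime hp]
  refine mem_of_eq_sum_of_pow_invariant hp hm hζ hrank hFle hF4 f fun v x => ?_
  have : (f (v ^ 4 * x) : ℂ) = f x := by
    rw [hf, hf, map_mul, map_pow, hv4, one_mul]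
  exact_mod_cast this

/-- **Corollary 5.**  Let `p` be a prime with `p ≡ 1 (mod 8)`, `k = ℚ(√p)` (inside `ℂ`), `F`
the quartic subfield of `ℚ(μ_p)` (inside `ℂ`), and `ε` a unit of the ring of integers of `k`
which is positive in the real embedding sending `√p` to the positive square root, with
`N_{k/ℚ}(ε) = −1`.  Then the compositum `F(p^{1/4})`, obtained by adjoining to `F` the fourth
root `α` of `p` whose square is the chosen square root `√p`, equals `F(√ε)`, the quadratic
extension of `F` obtained by adjoining a square root `c` of `ε`. -/
theorem adjoin_fourth_root_eq_adjoin_sqrt_unit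
    (p : ℕ) (hp : p.Prime) (hp8 : p % 8 = 1)
    (k : IntermediateField ℚ ℂ) (hk : k = ℚ⟮(Real.sqrt p : ℂ)⟯) [NumberField k]
    (ε : (𝓞 k)ˣ)
    (hεpos : ∃ r : ℝ, 0 < r ∧ (((ε : 𝓞 k) : k) : ℂ) = r)
    (hεnorm : Algebra.norm ℚ ((ε : 𝓞 k) : k) = -1)
    (ζ : ℂ) (hζ : IsPrimitiveRoot ζ p)
    (F : IntermediateField ℚ ℂ) (hFle : F ≤ ℚ⟮ζ⟯) (hF4 : Module.finrank ℚ F = 4)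
    (α : ℂ) (hα4 : α ^ 4 = (p : ℂ)) (hα2 : α ^ 2 = (Real.sqrt p : ℂ))
    (c : ℂ) (hc : c ^ 2 = (((ε : 𝓞 k) : k) : ℂ)) :
    IntermediateField.adjoin F {α} = IntermediateField.adjoin F {c} := by
  have hσ2 : (Real.sqrt p : ℂ) ^ 2 = p := by rw [← hα2, ← hα4]; ring
  obtain ⟨T, U, hU, hT, hTU, hε⟩ := exists_unit_eq_add_mul_sqrt hp hp8 hk hεpos hεnorm
  obtain ⟨a, b, g, θ, ha, hb, hab, hg, hθ, hθF⟩ := exists_sqrt_mem_quartic hp hp8 hζ hFle hF4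
  rw [hε] at hc
  generalize (Real.sqrt p : ℂ) = σ at *
  have ha0 : (a : ℂ) ≠ 0 := by
    rintro h
    rw [Int.cast_eq_zero] at h
    rw [h] at ha
    simp at ha
  have hgF : g ∈ F := by
    have : g = (θ ^ 2 - 2 * p) / (2 * a) := by field_simp; linear_combination -hθ
    rw [this]
    exact div_mem (sub_mem (pow_mem hθF 2) (mul_mem (ofNat_mem F 2) (_root_.natCast_mem F p)))
      (mul_mem (ofNat_mem F 2) (intCast_mem F a))
  have hsign : σ ∈ F ∧ ∃ a' : ℤ, a' ^ 2 + b ^ 2 = p ∧ g * a = σ * a' := by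
    rcases sq_eq_sq_iff_eq_or_eq_neg.1 (hg.trans hσ2.symm) with rfl | h
    · exact ⟨hgF, a, hab, rfl⟩
    · refine ⟨by rw [← neg_neg σ, ← h]; exact neg_mem hgF, -a, by rw [neg_sq, hab], ?_⟩
      rw [h]; push_cast; ring
  obtain ⟨hσF, a', hab', hga⟩ := hsign
  obtain ⟨m, n, hw⟩ := exists_two_mul_add_mul_eq_sq hp hb hab' hT hU hTU hσ2
  set w : ℂ := m + n * σ with hwdef
  have hwF : w ∈ F := add_mem (intCast_mem F m) (mul_mem (intCast_mem F n) hσF)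
  have hp0 : (p : ℂ) ≠ 0 := by exact_mod_cast hp.ne_zero
  have hσ0 : σ ≠ 0 := by rintro rfl; exact hp0 (by rw [← hσ2]; ring)
  have hα0 : α ≠ 0 := by rintro rfl; exact hσ0 (by rw [← hα2]; ring)
  have hc0 : c ≠ 0 := by
    rintro rfl
    have h1 : (T ^ 2 : ℂ) = p * U ^ 2 := by
      rw [← hσ2]; linear_combination -(T - U * σ) * hc
    have h2 : T ^ 2 = p * U ^ 2 := by exact_mod_cast h1
    omega
  have hθ0 : θ ≠ 0 := by
    rintro rfl
    have h1 : (p : ℂ) * (a ^ 2 : ℤ) = p * p := by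
      push_cast
      linear_combination -a ^ 2 * hg + (p / 2 - g * a / 2) * hθ
    have h2 := mul_left_cancel₀ hp0 h1
    apply hp.ratCast_sq_ne a
    exact_mod_cast h2
  have key : (θ * c) ^ 2 = (α * w) ^ 2 := by
    rw [mul_pow, mul_pow, ← hw, hc, hθ, hα2]
    linear_combination 2 * (T + U * σ) * hga - 2 * (T + U * σ) * hσ2
  have hw0 : w ≠ 0 := by
    intro h
    rw [h, mul_zero, zero_pow two_ne_zero] at key
    exact mul_ne_zero hθ0 hc0 (pow_eq_zero_iff two_ne_zero |>.1 key)
  obtain ⟨w', hw'F, hw'0, hw'⟩ : ∃ w' ∈ F, w' ≠ 0 ∧ θ * c = α * w' := by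
    rcases sq_eq_sq_iff_eq_or_eq_neg.1 key with h | h
    · exact ⟨w, hwF, hw0, h⟩
    · exact ⟨-w, neg_mem hwF, neg_ne_zero.2 hw0, by rw [h]; ring⟩
  apply le_antisymm <;> rw [IntermediateField.adjoin_simple_le_iff]
  · have : α = θ / w' * c := by field_simp; linear_combination -hw'
    rw [this]
    exact mul_mem ((IntermediateField.adjoin F {c}).algebraMap_mem ⟨θ / w', div_mem hθF hw'F⟩)
      (IntermediateField.mem_adjoin_simple_self F c)
  · have : c = w' / θ * α := by field_simp; linear_combination hw'
    rw [this]
    exact mul_mem ((IntermediateField.adjoin F {α}).algebraMap_mem ⟨w' / θ, div_mem hw'F hθF⟩)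
      (IntermediateField.mem_adjoin_simple_self F α)
end

section
/- Let p be a prime with p ≡ 1 (mod 8), k = ℚ(√p), and ε a unit of the ring of integers of k with ε > 0 and N_{k/ℚ}(ε) = −1. Then the class number of k(√ε) is odd. -/
set_option maxHeartbeats 1000000
set_option synthInstance.maxHeartbeats 400000

open NumberField IntermediateField

namespace OddClassNumber

section Dedekind

variable {R : Type*} [CommRing R] [IsDedekindDomain R]

theorem dvd_of_sq_dvd_sq {I J : Ideal R} (h : I ^ 2 ∣ J ^ 2) : I ∣ J := by
  classical
  rcases eq_or_ne J 0 with rfl | hJ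
  · exact dvd_zero _
  have hI : I ≠ 0 := by
    rintro rfl
    rw [zero_pow two_ne_zero, zero_dvd_iff] at h
    exact hJ (pow_eq_zero_iff two_ne_zero |>.mp h)
  rw [UniqueFactorizationMonoid.dvd_iff_normalizedFactors_le_normalizedFactors
    (pow_ne_zero 2 hI) (pow_ne_zero 2 hJ), UniqueFactorizationMonoid.normalizedFactors_pow,
    UniqueFactorizationMonoid.normalizedFactors_pow, Multiset.le_iff_count] at h
  rw [UniqueFactorizationMonoid.dvd_iff_normalizedFactors_le_normalizedFactors hI hJ,
    Multiset.le_iff_count]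
  intro a
  have := h a
  simpa using this

theorem eq_of_sq_eq_sq {I J : Ideal R} (h : I ^ 2 = J ^ 2) : I = J :=
  dvd_antisymm (dvd_of_sq_dvd_sq h.dvd) (dvd_of_sq_dvd_sq h.symm.dvd)

theorem exists_eq_sq_of_even_multiplicity {I : Ideal R} (hI : I ≠ 0)
    (h : ∀ q : Ideal R, q.IsPrime → q ≠ ⊥ → Even (multiplicity q I)) :
    ∃ J : Ideal R, I = J ^ 2 := by
  classical
  obtain ⟨u, hu⟩ := Multiset.exists_smul_of_dvd_count
    (UniqueFactorizationMonoid.normalizedFactors I) (k := 2) (by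
      intro q hq
      have hqp := UniqueFactorizationMonoid.prime_of_normalized_factor q hq
      have := h q (Ideal.isPrime_of_prime hqp) hqp.ne_zero
      rw [← even_iff_two_dvd]
      convert! this
      have h1 := UniqueFactorizationMonoid.emultiplicity_eq_count_normalizedFactors
        hqp.irreducible hI
      rw [normalize_eq] at h1
      exact (multiplicity_eq_of_emultiplicity_eq_some h1).symm)
  refine ⟨u.prod, ?_⟩
  rw [← Multiset.prod_nsmul, ← hu]
  exact (UniqueFactorizationMonoid.prod_normalizedFactors_eq hI).trans (normalize_eq I) |>.symm

end Dedekind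

theorem odd_classNumber_iff (K : Type*) [Field K] [NumberField K] :
    Odd (classNumber K) ↔ ∀ a : 𝓞 K, a ≠ 0 → (∃ I : Ideal (𝓞 K), Ideal.span {a} = I ^ 2) →
      ∃ (u : (𝓞 K)ˣ) (y : 𝓞 K), a = u * y ^ 2 := by
  classical
  constructor
  · rintro hodd a ha ⟨I, hI⟩
    have hI0 : I ≠ 0 := by
      rintro rfl
      simp at hI
      exact ha hI
    have hIm : I ∈ nonZeroDivisors (Ideal (𝓞 K)) := mem_nonZeroDivisors_of_ne_zero hI0
    have h2 : ClassGroup.mk0 (⟨I, hIm⟩ : nonZeroDivisors (Ideal (𝓞 K))) ^ 2 = 1 := by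
      rw [← map_pow]
      change ClassGroup.mk0 (⟨I ^ 2, pow_mem hIm 2⟩ : nonZeroDivisors (Ideal (𝓞 K))) = 1
      rw [ClassGroup.mk0_eq_one_iff, ← hI]
      exact ⟨a, rfl⟩
    have h1 : ClassGroup.mk0 (⟨I, hIm⟩ : nonZeroDivisors (Ideal (𝓞 K))) = 1 := by
      rw [← orderOf_eq_one_iff]
      have ha := orderOf_dvd_of_pow_eq_one h2
      have hb := orderOf_dvd_card
        (x := ClassGroup.mk0 (⟨I, hIm⟩ : nonZeroDivisors (Ideal (𝓞 K))))
      exact Nat.Coprime.eq_one_of_dvd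
        (Nat.Coprime.coprime_dvd_left hb hodd.coprime_two_right) ha
    rw [ClassGroup.mk0_eq_one_iff] at h1
    obtain ⟨y, hy⟩ := h1
    have hy' : I = Ideal.span {y} := hy
    rw [hy', Ideal.span_singleton_pow, Ideal.span_singleton_eq_span_singleton] at hI
    obtain ⟨u, hu⟩ := hI.symm
    exact ⟨u, y, by rw [← hu, mul_comm]⟩
  · intro h
    by_contra hodd
    rw [Nat.not_odd_iff_even, even_iff_two_dvd] at hodd
    obtain ⟨c, hc⟩ := exists_prime_orderOf_dvd_card (G := ClassGroup (𝓞 K)) 2 hodd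
    obtain ⟨⟨I, hIm⟩, rfl⟩ := ClassGroup.mk0_surjective c
    have h2 := pow_orderOf_eq_one (ClassGroup.mk0 (⟨I, hIm⟩ : nonZeroDivisors (Ideal (𝓞 K))))
    rw [hc, ← map_pow] at h2
    change ClassGroup.mk0 (⟨I ^ 2, pow_mem hIm 2⟩ : nonZeroDivisors (Ideal (𝓞 K))) = 1 at h2
    rw [ClassGroup.mk0_eq_one_iff] at h2
    obtain ⟨a, ha⟩ := h2
    have ha' : I ^ 2 = Ideal.span {a} := ha
    have ha0 : a ≠ 0 := by
      rintro rfl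
      exact pow_ne_zero 2 (nonZeroDivisors.ne_zero hIm) (by rw [ha']; simp)
    obtain ⟨u, y, rfl⟩ := h a ha0 ⟨I, ha'.symm⟩
    rw [mul_comm, Ideal.span_singleton_mul_right_unit u.isUnit, ← Ideal.span_singleton_pow] at ha'
    have h1 : ClassGroup.mk0 (⟨I, hIm⟩ : nonZeroDivisors (Ideal (𝓞 K))) = 1 := by
      rw [ClassGroup.mk0_eq_one_iff]
      exact ⟨y, eq_of_sq_eq_sq ha'⟩
    rw [h1, orderOf_one] at hc
    omega

section Ramification

variable {F L : Type*} [Field F] [NumberField F] [Field L] [NumberField L] [Algebra F L]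
  [IsGalois F L]

theorem ramificationIdx_eq_one_of_inertia_trivial (q : Ideal (𝓞 F)) [q.IsPrime] (hq : q ≠ ⊥)
    (Q : Ideal (𝓞 L)) [Q.IsPrime] [Q.LiesOver q]
    (h : ∀ τ : Gal(L/F), (∀ x : 𝓞 L, τ • x - x ∈ Q) → τ = 1) :
    q.ramificationIdx' Q = 1 := by
  have : q.IsMaximal := Ring.DimensionLEOne.maximalOfPrime hq inferInstance
  have : Module.Finite (𝓞 F) (𝓞 L) := IsIntegralClosure.finite (𝓞 F) F L (𝓞 L)
  have hc := Ideal.card_inertia_eq_ramificationIdxIn (G := Gal(L/F)) q Q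
  rw [Ideal.ramificationIdxIn_eq_ramificationIdx q Q Gal(L/F),
    ← Ideal.ramificationIdx'_eq_ramificationIdx q Q hq] at hc
  rw [← hc, Nat.card_eq_one_iff_unique]
  refine ⟨⟨fun a b => Subtype.ext ?_⟩, ⟨1⟩⟩
  rw [h a.1 a.2, h b.1 b.2]

theorem even_multiplicity_of_span_eq_sq {d : 𝓞 F} (hd : d ≠ 0) {J : Ideal (𝓞 L)}
    (hJ : Ideal.span {algebraMap (𝓞 F) (𝓞 L) d} = J ^ 2) (q : Ideal (𝓞 F)) [hqp : q.IsPrime]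
    (hq : q ≠ ⊥) (h : ∀ Q : Ideal (𝓞 L), Q.IsPrime → Q.LiesOver q →
      ∀ τ : Gal(L/F), (∀ x : 𝓞 L, τ • x - x ∈ Q) → τ = 1) :
    Even (multiplicity q (Ideal.span {d})) := by
  have : q.IsMaximal := Ring.DimensionLEOne.maximalOfPrime hq inferInstance
  obtain ⟨Q, hQmax, hQ⟩ := Ideal.exists_maximal_ideal_liesOver_of_isIntegral (S := 𝓞 L) q
  have hQ0 : Q ≠ ⊥ := Ideal.ne_bot_of_liesOver_of_ne_bot hq Q
  have he := ramificationIdx_eq_one_of_inertia_trivial q hq Q (h Q inferInstance hQ)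
  have hd' : Ideal.span {d} ≠ ⊥ := by simpa using hd
  have hqpr := Ideal.prime_of_isPrime hq hqp
  have hQpr := Ideal.prime_of_isPrime hQ0 hQmax.isPrime
  have hm := Ideal.IsDedekindDomain.emultiplicity_map_eq_ramificationIdx'_mul (S := 𝓞 L) hd'
    hqpr.irreducible hQpr.irreducible hQ0
  rw [he, Ideal.map_span, Set.image_singleton, hJ, emultiplicity_pow hQpr,
    (FiniteMultiplicity.of_prime_left hqpr hd').emultiplicity_eq_multiplicity] at hm
  have hJ0 : J ≠ 0 := by
    rintro rfl
    simp at hJ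
    exact hd hJ
  rw [(FiniteMultiplicity.of_prime_left hQpr hJ0).emultiplicity_eq_multiplicity] at hm
  have : 2 * multiplicity Q J = multiplicity q (Ideal.span {d}) := by
    rw [← one_mul (multiplicity q _)]
    exact_mod_cast hm
  exact ⟨_, by rw [← this, two_mul]⟩

end Ramification

/-- `x` is a unit of the ring of integers times a square of the field. -/
def IsUnitMulSq (K : Type*) [Field K] [NumberField K] (x : K) : Prop :=
  ∃ (u : (𝓞 K)ˣ) (y : K), x = ((u : 𝓞 K) : K) * y ^ 2

section IsUnitMulSq

variable {K : Type*} [Field K] [NumberField K]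

theorem IsUnitMulSq.of_mul_sq {x y z : K} (hz : z ≠ 0) (h : IsUnitMulSq K y)
    (hxy : z ^ 2 * x = y) : IsUnitMulSq K x := by
  obtain ⟨u, w, rfl⟩ := h
  refine ⟨u, w / z, ?_⟩
  field_simp
  linear_combination hxy

theorem IsUnitMulSq.unit_mul {x : K} (h : IsUnitMulSq K x) (w : (𝓞 K)ˣ) :
    IsUnitMulSq K (((w : 𝓞 K) : K) * x) := by
  obtain ⟨u, y, rfl⟩ := h
  exact ⟨w * u, y, by push_cast; ring⟩

theorem IsUnitMulSq.mul {x y : K} (hx : IsUnitMulSq K x) (hy : IsUnitMulSq K y) :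
    IsUnitMulSq K (x * y) := by
  obtain ⟨u, a, rfl⟩ := hx
  obtain ⟨v, b, rfl⟩ := hy
  exact ⟨u * v, a * b, by push_cast; ring⟩

theorem IsUnitMulSq.mul_sq {x : K} (h : IsUnitMulSq K x) (z : K) :
    IsUnitMulSq K (x * z ^ 2) := by
  obtain ⟨u, y, rfl⟩ := h
  exact ⟨u, y * z, by ring⟩

theorem IsUnitMulSq.exists_integer {a : 𝓞 K} (h : IsUnitMulSq K (a : K)) :
    ∃ (u : (𝓞 K)ˣ) (y : 𝓞 K), a = u * y ^ 2 := by
  obtain ⟨u, y, hy⟩ := h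
  have h2 : y ^ 2 = (((u⁻¹ : (𝓞 K)ˣ) * a : 𝓞 K) : K) := by
    rw [RingOfIntegers.coe_eq_algebraMap, map_mul, ← RingOfIntegers.coe_eq_algebraMap a, hy,
      RingOfIntegers.coe_eq_algebraMap, ← mul_assoc, ← map_mul, Units.inv_mul, map_one, one_mul]
  have hInt : IsIntegral ℤ y := by
    refine IsIntegral.of_pow (n := 2) (by norm_num) ?_
    rw [h2]
    exact RingOfIntegers.isIntegral_coe _
  obtain ⟨z, rfl⟩ : ∃ z : 𝓞 K, (z : K) = y := ⟨⟨y, hInt⟩, rfl⟩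
  refine ⟨u, z, RingOfIntegers.ext ?_⟩
  push_cast
  exact hy

theorem odd_classNumber_iff_isUnitMulSq (K : Type*) [Field K] [NumberField K] :
    Odd (classNumber K) ↔ ∀ a : 𝓞 K, a ≠ 0 → (∃ I : Ideal (𝓞 K), Ideal.span {a} = I ^ 2) →
      IsUnitMulSq K (a : K) := by
  rw [odd_classNumber_iff]
  refine forall₃_congr fun a ha hI => ⟨?_, IsUnitMulSq.exists_integer⟩
  rintro ⟨u, y, rfl⟩
  exact ⟨u, y, by push_cast; rfl⟩

end IsUnitMulSq

section Quadratic

variable {F L : Type} [Field F] [NumberField F] [Field L] [NumberField L] [Algebra F L]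
  [IsGalois F L] {σ : Gal(L/F)}

omit [NumberField F] [NumberField L] [IsGalois F L] in
theorem mem_zpowers_of_forall_eq (hσ : ∀ τ : Gal(L/F), τ = 1 ∨ τ = σ) (x : Gal(L/F)) :
    x ∈ Subgroup.zpowers σ := by
  rcases hσ x with rfl | rfl
  · exact one_mem _
  · exact Subgroup.mem_zpowers _

theorem algebraMap_norm_eq (hσ : ∀ τ : Gal(L/F), τ = 1 ∨ τ = σ) (hσ1 : σ ≠ 1) (x : L) :
    algebraMap F L (Algebra.norm F x) = x * σ x := by
  classical
  have : (Finset.univ : Finset Gal(L/F)) = {1, σ} := by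
    ext τ
    simpa using hσ τ
  rw [Algebra.norm_eq_prod_automorphisms, this, Finset.prod_pair hσ1.symm]
  rfl

omit [IsGalois F L] in
theorem norm_div_eq (x y : L) :
    Algebra.norm F (x / y) = Algebra.norm F x / Algebra.norm F y := by
  rw [div_eq_mul_inv, map_mul, Algebra.norm_inv, div_eq_mul_inv]

/-- Hilbert 90 with an integral element. -/
theorem exists_integer_of_norm_eq_one (hσ : ∀ τ : Gal(L/F), τ = 1 ∨ τ = σ) (hσ1 : σ ≠ 1) {x : L}
    (hx : Algebra.norm F x = 1) :
    ∃ b : 𝓞 L, b ≠ 0 ∧ x * algebraMap F L (Algebra.norm F (b : L)) = (b : L) ^ 2 := by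
  have : IsCyclic Gal(L/F) := ⟨σ, mem_zpowers_of_forall_eq hσ⟩
  obtain ⟨y, hy⟩ := groupCohomology.exists_div_of_norm_eq_one (mem_zpowers_of_forall_eq hσ) hx
  obtain ⟨b, c, hc, hbc⟩ := IsFractionRing.div_surjective (A := 𝓞 L) (y : L)
  have : Module.Finite (𝓞 F) (𝓞 L) := IsIntegralClosure.finite (𝓞 F) F L (𝓞 L)
  have hc0 : c ≠ 0 := nonZeroDivisors.ne_zero hc
  have hcL : algebraMap (𝓞 L) L c ≠ 0 := by simpa using hc0
  have hy0 : (y : L) ≠ 0 := y.ne_zero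
  have hσy : σ (y : L) ≠ 0 := by simp
  have hσc : σ (algebraMap (𝓞 L) L c) ≠ 0 := by simpa using hc0
  have hb0 : algebraMap (𝓞 L) L b ≠ 0 := by
    intro h
    rw [h, zero_div] at hbc
    exact hy0 hbc.symm
  refine ⟨b * σ • c, ?_, ?_⟩
  · refine mul_ne_zero (fun h => hb0 (by rw [h, map_zero])) ?_
    rwa [Ne, smul_eq_zero_iff_eq]
  have e1 : ((b * σ • c : 𝓞 L) : L) = y * (algebraMap (𝓞 L) L c * σ (algebraMap (𝓞 L) L c)) := by
    rw [← hbc]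
    push_cast
    rw [div_mul_eq_mul_div, eq_div_iff hcL]
    change algebraMap (𝓞 L) L b * σ (algebraMap (𝓞 L) L c) * _ = _
    ring
  rw [e1, algebraMap_norm_eq hσ hσ1, ← hy, map_mul, ← algebraMap_norm_eq hσ hσ1,
    AlgEquiv.commutes]
  field_simp

theorem odd_classNumber_of_quadratic (hσ : ∀ τ : Gal(L/F), τ = 1 ∨ τ = σ) (hσ1 : σ ≠ 1)
    (hF : Odd (classNumber F))
    (hunit : ∀ u : (𝓞 F)ˣ, (∃ x : L, Algebra.norm F x = ((u : 𝓞 F) : F)) →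
      ∃ w : (𝓞 L)ˣ, Algebra.norm F ((w : 𝓞 L) : L) = ((u : 𝓞 F) : F))
    (𝔭 : Ideal (𝓞 F))
    (hram : ∀ Q : Ideal (𝓞 L), Q.IsPrime → Q ≠ ⊥ → (∀ x : 𝓞 L, σ • x - x ∈ Q) →
      Q.under (𝓞 F) = 𝔭)
    (m : 𝓞 F) (hmF : ¬ IsUnitMulSq F (m : F)) (hmL : IsUnitMulSq L (algebraMap F L (m : F))) :
    Odd (classNumber L) := by
  have hm0 : m ≠ 0 := by
    rintro rfl
    exact hmF ⟨1, 0, by simp⟩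
  have heven : ∀ d : 𝓞 F, d ≠ 0 →
      (∃ J : Ideal (𝓞 L), Ideal.span {algebraMap (𝓞 F) (𝓞 L) d} = J ^ 2) →
      ∀ q : Ideal (𝓞 F), q.IsPrime → q ≠ ⊥ → q ≠ 𝔭 → Even (multiplicity q (Ideal.span {d})) := by
    rintro d hd ⟨J, hJ⟩ q hqp hq hq𝔭
    refine even_multiplicity_of_span_eq_sq hd hJ q hq fun Q hQ hQq τ hτ => ?_
    rcases hσ τ with h | h
    · exact h
    · rw [h] at hτ
      exact absurd (hQq.over.trans
        (hram Q hQ (Ideal.ne_bot_of_liesOver_of_ne_bot hq Q) hτ)) hq𝔭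
  have hsel : ∀ d : 𝓞 F, d ≠ 0 →
      (∃ J : Ideal (𝓞 L), Ideal.span {algebraMap (𝓞 F) (𝓞 L) d} = J ^ 2) →
      (𝔭.IsPrime → 𝔭 ≠ ⊥ → Even (multiplicity 𝔭 (Ideal.span {d}))) → IsUnitMulSq F (d : F) := by
    intro d hd hJ h𝔭
    refine (odd_classNumber_iff_isUnitMulSq F).1 hF d hd
      (exists_eq_sq_of_even_multiplicity (by simpa using hd) fun q hqp hq => ?_)
    by_cases hq𝔭 : q = 𝔭
    · subst hq𝔭
      exact h𝔭 hqp hq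
    · exact heven d hd hJ q hqp hq hq𝔭
  obtain ⟨um, ym, hmy⟩ : ∃ (u : (𝓞 L)ˣ) (y : 𝓞 L), algebraMap (𝓞 F) (𝓞 L) m = u * y ^ 2 :=
    IsUnitMulSq.exists_integer hmL
  have hmJ : Ideal.span {algebraMap (𝓞 F) (𝓞 L) m} = Ideal.span {ym} ^ 2 := by
    rw [hmy, mul_comm, Ideal.span_singleton_mul_right_unit um.isUnit, Ideal.span_singleton_pow]
  have h𝔭m : 𝔭.IsPrime ∧ 𝔭 ≠ ⊥ ∧ ¬ Even (multiplicity 𝔭 (Ideal.span {m})) := by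
    by_contra hcon
    refine hmF (hsel m hm0 ⟨_, hmJ⟩ fun h1 h2 => ?_)
    by_contra h3
    exact hcon ⟨h1, h2, h3⟩
  obtain ⟨h𝔭1, h𝔭2, h𝔭3⟩ := h𝔭m
  have key : ∀ d : 𝓞 F, d ≠ 0 →
      (∃ J : Ideal (𝓞 L), Ideal.span {algebraMap (𝓞 F) (𝓞 L) d} = J ^ 2) →
      IsUnitMulSq L (algebraMap F L (d : F)) := by
    have hext : ∀ x : F, IsUnitMulSq F x → IsUnitMulSq L (algebraMap F L x) := by
      rintro x ⟨u, y, rfl⟩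
      refine ⟨Units.map (algebraMap (𝓞 F) (𝓞 L)).toMonoidHom u, algebraMap F L y, ?_⟩
      rw [map_mul, map_pow]
      rfl
    rintro d hd ⟨J, hJ⟩
    by_cases hev : Even (multiplicity 𝔭 (Ideal.span {d}))
    · exact hext _ (hsel d hd ⟨J, hJ⟩ fun _ _ => hev)
    · have hdm : IsUnitMulSq F ((d * m : 𝓞 F) : F) := by
        refine hsel _ (mul_ne_zero hd hm0) ⟨J * Ideal.span {ym}, ?_⟩ fun _ _ => ?_
        · rw [map_mul, ← Ideal.span_singleton_mul_span_singleton, hJ, hmJ, mul_pow]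
        · have hpr := Ideal.prime_of_isPrime h𝔭2 h𝔭1
          rw [← Ideal.span_singleton_mul_span_singleton, multiplicity_mul hpr]
          · rw [Nat.not_even_iff_odd] at hev h𝔭3
            exact hev.add_odd h𝔭3
          · refine FiniteMultiplicity.of_prime_left hpr ?_
            rw [Ideal.span_singleton_mul_span_singleton]
            simpa using ⟨hd, hm0⟩
      have hm0' : algebraMap F L (m : F) ≠ 0 := by simpa using hm0
      refine IsUnitMulSq.of_mul_sq hm0' ((hext _ hdm).mul hmL) ?_
      push_cast
      ring
  rw [odd_classNumber_iff_isUnitMulSq]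
  rintro a ha ⟨I, hI⟩
  have : Module.Finite (𝓞 F) (𝓞 L) := IsIntegralClosure.finite (𝓞 F) F L (𝓞 L)
  have hnorm : ((Algebra.intNorm (𝓞 F) (𝓞 L) a : 𝓞 F) : F) = Algebra.norm F (a : L) :=
    Algebra.algebraMap_intNorm (L := L) a
  have ha0 : (a : L) ≠ 0 := by simpa using ha
  have hn0 : Algebra.intNorm (𝓞 F) (𝓞 L) a ≠ 0 := by
    intro h
    rw [h] at hnorm
    exact ha0 (Algebra.norm_eq_zero_iff.1 (hnorm.symm.trans (by simp)))
  obtain ⟨u, n, hun⟩ : ∃ (u : (𝓞 F)ˣ) (n : 𝓞 F), Algebra.intNorm (𝓞 F) (𝓞 L) a = u * n ^ 2 :=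
    (odd_classNumber_iff F).1 hF _ hn0
      ⟨Ideal.relNorm (𝓞 F) I, by rw [← Ideal.relNorm_singleton, hI, map_pow]⟩
  have hn : n ≠ 0 := by
    rintro rfl
    exact hn0 (hun.trans (by simp))
  have hnF : (n : F) ≠ 0 := by simpa using hn
  have hnL : algebraMap F L (n : F) ≠ 0 := by simpa using hn
  have hf2 : Module.finrank F L = 2 := by
    classical
    rw [← IsGalois.card_aut_eq_finrank, Nat.card_eq_fintype_card, ← Finset.card_univ,
      show (Finset.univ : Finset Gal(L/F)) = {1, σ} by ext τ; simpa using hσ τ,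
      Finset.card_pair hσ1.symm]
  rw [hun] at hnorm
  push_cast at hnorm
  obtain ⟨w, hw⟩ := hunit u ⟨(a : L) / algebraMap F L (n : F), by
    rw [norm_div_eq, ← hnorm, Algebra.norm_algebraMap, hf2]
    field_simp⟩
  have hw0 : ((w : 𝓞 L) : L) ≠ 0 := by simp
  have hu0 : ((u : 𝓞 F) : F) ≠ 0 := by simp
  have h1 : Algebra.norm F ((a : L) / (((w : 𝓞 L) : L) * algebraMap F L (n : F))) = 1 := by
    rw [norm_div_eq, map_mul, hw, ← hnorm, Algebra.norm_algebraMap, hf2]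
    field_simp
  obtain ⟨b, hb, hab⟩ := exists_integer_of_norm_eq_one hσ hσ1 h1
  set N : 𝓞 F := Algebra.intNorm (𝓞 F) (𝓞 L) b with hN
  have hNb : (N : F) = Algebra.norm F (b : L) := Algebra.algebraMap_intNorm (L := L) b
  have hb0 : (b : L) ≠ 0 := by simpa using hb
  have hNF : (N : F) ≠ 0 := by
    rw [hNb]
    exact fun h => hb0 (Algebra.norm_eq_zero_iff.1 h)
  have hN0 : N ≠ 0 := by
    rintro h
    simp [h] at hNF
  have hNL : algebraMap F L (N : F) ≠ 0 := by simpa using hN0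
  rw [← hNb] at hab
  have hmain : (algebraMap F L (N : F)) ^ 2 * (a : L)
      = ((w : 𝓞 L) : L) * (algebraMap F L ((n * N : 𝓞 F) : F) * (b : L) ^ 2) := by
    rw [← hab]
    push_cast
    field_simp
  have hmainO : (algebraMap (𝓞 F) (𝓞 L) N) ^ 2 * a
      = w * (algebraMap (𝓞 F) (𝓞 L) (n * N) * b ^ 2) := by
    have e : ∀ x : 𝓞 F, ((algebraMap (𝓞 F) (𝓞 L) x : 𝓞 L) : L) = algebraMap F L (x : F) :=
      fun _ => rfl
    apply RingOfIntegers.ext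
    rw [← e, ← e] at hmain
    exact_mod_cast hmain
  refine IsUnitMulSq.of_mul_sq hNL (((key (n * N) (mul_ne_zero hn hN0) ?_).mul_sq b).unit_mul w)
    hmain
  have hid : Ideal.span {algebraMap (𝓞 F) (𝓞 L) (n * N)} * Ideal.span {b} ^ 2
      = (Ideal.span {algebraMap (𝓞 F) (𝓞 L) N} * I) ^ 2 := by
    rw [mul_pow, ← hI, Ideal.span_singleton_pow, Ideal.span_singleton_pow,
      Ideal.span_singleton_mul_span_singleton, Ideal.span_singleton_mul_span_singleton, hmainO,
      mul_comm (w : 𝓞 L), Ideal.span_singleton_mul_right_unit w.isUnit]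
  obtain ⟨J, hJ⟩ := dvd_of_sq_dvd_sq (Dvd.intro_left _ hid)
  refine ⟨J, ?_⟩
  rw [hJ, mul_pow, mul_comm] at hid
  exact mul_left_cancel₀ (pow_ne_zero 2 (by simpa using hb)) hid

end Quadratic

section QuadraticGenerator

theorem exists_generator_of_finrank_eq_two {F L : Type*} [Field F] [CharZero F] [Field L]
    [Algebra F L] (h2 : Module.finrank F L = 2) :
    IsGalois F L ∧ ∃ σ : Gal(L/F), (∀ τ : Gal(L/F), τ = 1 ∨ τ = σ) ∧ σ ≠ 1 := by
  classical
  have : Algebra.IsQuadraticExtension F L := ⟨h2⟩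
  have : FiniteDimensional F L := Module.finite_of_finrank_pos (by omega)
  have hG : IsGalois F L := ⟨⟩
  refine ⟨hG, ?_⟩
  have hcard := IsGalois.card_aut_eq_finrank F L
  rw [h2, Nat.card_eq_two_iff' (1 : Gal(L/F))] at hcard
  obtain ⟨σ, hσ, hu⟩ := hcard
  exact ⟨σ, fun τ => or_iff_not_imp_left.2 (hu τ), hσ⟩

variable {F L : Type} [Field F] [NumberField F] [Field L] [NumberField L] [Algebra F L]
  [IsGalois F L] {σ : Gal(L/F)}

theorem exists_algebraMap_of_fixed (hσ : ∀ τ : Gal(L/F), τ = 1 ∨ τ = σ) {x : L} (hx : σ x = x) :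
    ∃ y : F, algebraMap F L y = x := by
  refine (IsGalois.mem_range_algebraMap_iff_fixed x).2 fun τ => ?_
  rcases hσ τ with rfl | rfl
  · rfl
  · exact hx

theorem apply_sqrt_eq_neg (hσ : ∀ τ : Gal(L/F), τ = 1 ∨ τ = σ) {s : L} {D : F}
    (hs : s ^ 2 = algebraMap F L D) (hsF : ∀ y : F, algebraMap F L y ≠ s) : σ s = -s := by
  have h : (σ s) ^ 2 = s ^ 2 := by rw [← map_pow, hs, AlgEquiv.commutes]
  rcases sq_eq_sq_iff_eq_or_eq_neg.1 h with h | h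
  · obtain ⟨y, hy⟩ := exists_algebraMap_of_fixed hσ h
    exact absurd hy (hsF y)
  · exact h

theorem exists_norm_eq_sq_sub (hσ : ∀ τ : Gal(L/F), τ = 1 ∨ τ = σ) (hσ1 : σ ≠ 1) {s : L} {D : F}
    (hs : s ^ 2 = algebraMap F L D) (hsF : ∀ y : F, algebraMap F L y ≠ s) (x : L) :
    ∃ a b : F, x = algebraMap F L a + algebraMap F L b * s ∧
      Algebra.norm F x = a ^ 2 - D * b ^ 2 := by
  have hσs := apply_sqrt_eq_neg hσ hs hsF
  have hs0 : s ≠ 0 := by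
    rintro rfl
    exact hsF 0 (map_zero _)
  have hσσ : σ (σ x) = x := by
    rcases hσ (σ * σ) with h | h
    · exact DFunLike.congr_fun h x
    · exact absurd (mul_eq_left.1 h) hσ1
  obtain ⟨a, ha⟩ := exists_algebraMap_of_fixed (x := (x + σ x) / 2) hσ (by
    rw [map_div₀, map_add, hσσ, map_ofNat, add_comm])
  obtain ⟨b, hb⟩ := exists_algebraMap_of_fixed (x := (x - σ x) / (2 * s)) hσ (by
    rw [map_div₀, map_sub, hσσ, map_mul, map_ofNat, hσs]
    field_simp
    ring)
  refine ⟨a, b, ?_, ?_⟩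
  · rw [ha, hb]
    field_simp
    ring
  · apply (algebraMap F L).injective
    rw [algebraMap_norm_eq hσ hσ1, map_sub, map_mul, map_pow, map_pow, ha, hb, ← hs]
    field_simp
    ring

end QuadraticGenerator

section RealQuadratic

theorem rat_unit_eq (u : (𝓞 ℚ)ˣ) : u = 1 ∨ u = -1 := by
  have := Int.isUnit_iff.1 (u.isUnit.map Rat.ringOfIntegersEquiv)
  rcases this with h | h
  · left
    exact Units.ext (Rat.ringOfIntegersEquiv.injective (by rw [h]; simp))
  · right
    exact Units.ext (Rat.ringOfIntegersEquiv.injective (by rw [h]; simp))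

theorem not_isUnitMulSq_rat_prime {p : ℕ} (hp : p.Prime) : ¬ IsUnitMulSq ℚ (p : ℚ) := by
  rintro ⟨u, y, h⟩
  have hu : ((u : 𝓞 ℚ) : ℚ) = 1 ∨ ((u : 𝓞 ℚ) : ℚ) = -1 := by
    rcases rat_unit_eq u with rfl | rfl <;> simp
  have hy : IsSquare (p : ℚ) := by
    rcases hu with hu | hu
    · rw [hu] at h
      exact ⟨y, by rw [h]; ring⟩
    · rw [hu] at h
      have : (0 : ℚ) < p := by exact_mod_cast hp.pos
      nlinarith [sq_nonneg y]
  rw [Rat.isSquare_natCast_iff] at hy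
  exact hp.prime.irreducible.not_isSquare hy

theorem odd_classNumber_quadratic {k : Type} [Field k] [NumberField k]
    (h2 : Module.finrank ℚ k = 2) {p : ℕ} (hp : p.Prime) {s ω : 𝓞 k} (hs : s ^ 2 = p)
    (hω : 2 * ω = 1 + s) (hs_rat : ∀ y : ℚ, algebraMap ℚ k y ≠ s)
    (ε : (𝓞 k)ˣ) (hε : Algebra.norm ℚ ((ε : 𝓞 k) : k) = -1) : Odd (classNumber k) := by
  obtain ⟨hG, σ, hσ, hσ1⟩ := exists_generator_of_finrank_eq_two h2
  have hsk : ((s : k)) ^ 2 = algebraMap ℚ k (p : ℚ) := by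
    have := congrArg (fun x : 𝓞 k => (x : k)) hs
    simpa using this
  have hσs := apply_sqrt_eq_neg hσ hsk hs_rat
  have hσsO : σ • s = -s := by
    apply RingOfIntegers.ext
    exact hσs.trans (by simp)
  have hσω : σ • ω - ω = -s := by
    have h1 := congrArg (fun x => σ • x) hω
    simp only [smul_mul', smul_add, smul_one, hσsO] at h1
    have h3 : σ • (2 : 𝓞 k) = 2 := by
      rw [← one_add_one_eq_two, smul_add, smul_one]
    rw [h3] at h1
    have : (2 : 𝓞 k) ≠ 0 := two_ne_zero
    apply mul_left_cancel₀ this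
    linear_combination h1 - hω
  refine odd_classNumber_of_quadratic hσ hσ1 (by rw [Rat.classNumber_eq]; exact odd_one) ?_
    (Ideal.span {(p : 𝓞 ℚ)}) ?_ (p : 𝓞 ℚ) ?_ ?_
  · intro u _
    rcases rat_unit_eq u with rfl | rfl
    · exact ⟨1, by simp⟩
    · exact ⟨ε, by rw [hε]; simp⟩
  · intro Q hQ hQ0 h
    have hsQ : s ∈ Q := by
      have := h ω
      rwa [hσω, neg_mem_iff] at this
    have hpQ : (p : 𝓞 ℚ) ∈ Q.under (𝓞 ℚ) := by
      rw [Ideal.mem_comap, map_natCast, ← hs]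
      exact Ideal.pow_mem_of_mem _ hsQ 2 two_pos
    have hpp : Prime (p : 𝓞 ℚ) := by
      rw [← MulEquiv.prime_iff (Rat.ringOfIntegersEquiv : 𝓞 ℚ ≃+* ℤ), map_natCast]
      exact Nat.prime_iff_prime_int.1 hp
    have hmax : (Ideal.span {(p : 𝓞 ℚ)}).IsMaximal :=
      Ring.DimensionLEOne.maximalOfPrime (by simpa using hpp.ne_zero)
        ((Ideal.span_singleton_prime hpp.ne_zero).2 hpp)
    have hQu : (Q.under (𝓞 ℚ)).IsPrime := inferInstance
    exact (hmax.eq_of_le hQu.ne_top ((Ideal.span_singleton_le_iff_mem _).2 hpQ)).symm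
  · have := not_isUnitMulSq_rat_prime hp
    simpa using this
  · refine ⟨1, (s : k), ?_⟩
    rw [hsk]
    simp

end RealQuadratic

section RealUnits

variable {k : Type} [Field k] [NumberField k]

theorem torsion_eq_one_or_neg_one_of_real (τ : k →+* ℝ) {u : (𝓞 k)ˣ} (hu : u ∈ Units.torsion k) :
    u = 1 ∨ u = -1 := by
  rw [Units.torsion, CommGroup.mem_torsion, isOfFinOrder_iff_pow_eq_one] at hu
  obtain ⟨n, hn, hun⟩ := hu
  have h : (τ ((u : 𝓞 k) : k)) ^ n = 1 := by
    rw [← map_pow]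
    have := congrArg (fun x : (𝓞 k)ˣ => ((x : 𝓞 k) : k)) hun
    simp only [Units.val_pow_eq_pow_val, map_pow, Units.val_one, map_one] at this
    rw [map_pow, ← map_pow, this, map_one]
  have habs := (pow_eq_one_iff_of_ne_zero hn.ne').1 h
  have hinj : Function.Injective fun x : 𝓞 k => τ (x : k) :=
    τ.injective.comp RingOfIntegers.coe_injective
  rcases habs with h1 | ⟨h1, -⟩
  · exact Or.inl (Units.ext (hinj (by simpa using h1)))
  · exact Or.inr (Units.ext (hinj (by simpa using h1)))

theorem rank_le_one_of_finrank_eq_two (h2 : Module.finrank ℚ k = 2) : Units.rank k ≤ 1 := by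
  have := InfinitePlace.card_add_two_mul_card_eq_rank k
  have h := InfinitePlace.card_eq_nrRealPlaces_add_nrComplexPlaces k
  rw [h2] at this
  rw [Units.rank, h]
  omega

theorem two_le_rank_of_finrank_eq_four (h4 : Module.finrank ℚ k = 4) (φ : k →+* ℝ) :
    2 ≤ Units.rank k := by
  classical
  have := InfinitePlace.card_add_two_mul_card_eq_rank k
  have h := InfinitePlace.card_eq_nrRealPlaces_add_nrComplexPlaces k
  have hpos : 0 < InfinitePlace.nrRealPlaces k := by
    have hr : ComplexEmbedding.IsReal (Complex.ofRealHom.comp φ) := by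
      rw [ComplexEmbedding.isReal_iff]
      ext x
      simp [ComplexEmbedding.conjugate]
    exact @Fintype.card_pos _ _ ⟨⟨InfinitePlace.mk _, _, hr, rfl⟩⟩
  rw [h4] at this
  rw [Units.rank, h]
  omega

theorem exists_generator_of_rank_le_one (τ : k →+* ℝ) (hr : Units.rank k ≤ 1) :
    ∃ w : (𝓞 k)ˣ, ∀ u : (𝓞 k)ˣ, ∃ n : ℤ, u = w ^ n ∨ u = -w ^ n := by
  have hsub : Subsingleton (Fin (Units.rank k)) := Fin.subsingleton_iff_le_one.2 hr
  refine ⟨∏ i, Units.fundSystem k i, fun u => ?_⟩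
  obtain ⟨⟨ζ, e⟩, h, -⟩ := Units.exist_unique_eq_mul_prod k u
  have hprod : ∃ n : ℤ, ∏ i, Units.fundSystem k i ^ e i = (∏ i, Units.fundSystem k i) ^ n := by
    rcases isEmpty_or_nonempty (Fin (Units.rank k)) with h0 | ⟨⟨i⟩⟩
    · exact ⟨0, by simp⟩
    · refine ⟨e i, ?_⟩
      rw [Fintype.prod_subsingleton _ i, Fintype.prod_subsingleton _ i]
  obtain ⟨n, hn⟩ := hprod
  refine ⟨n, ?_⟩
  simp only at h
  rw [hn] at h
  rcases torsion_eq_one_or_neg_one_of_real τ ζ.2 with h1 | h1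
  · left
    rw [h, h1, one_mul]
  · right
    rw [h, h1, neg_one_mul]

theorem eq_sq_of_totally_positive (h2 : Module.finrank ℚ k = 2) (τ₁ τ₂ : k →+* ℝ) {ε : (𝓞 k)ˣ}
    (hε₁ : 0 < τ₁ ((ε : 𝓞 k) : k)) (hε₂ : τ₂ ((ε : 𝓞 k) : k) < 0) {u : (𝓞 k)ˣ}
    (hu₁ : 0 < τ₁ ((u : 𝓞 k) : k)) (hu₂ : 0 < τ₂ ((u : 𝓞 k) : k)) : ∃ v : (𝓞 k)ˣ, u = v ^ 2 := by
  obtain ⟨w, hw⟩ := exists_generator_of_rank_le_one τ₁ (rank_le_one_of_finrank_eq_two h2)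
  have hsign : ∀ u : (𝓞 k)ˣ, (∃ v : (𝓞 k)ˣ, u = v ^ 2) ∨ (∃ v : (𝓞 k)ˣ, u = -v ^ 2) ∨
      (∃ v : (𝓞 k)ˣ, u = w * v ^ 2) ∨ (∃ v : (𝓞 k)ˣ, u = -(w * v ^ 2)) := by
    intro u
    obtain ⟨n, hn⟩ := hw u
    rcases Int.even_or_odd n with ⟨m, rfl⟩ | ⟨m, rfl⟩
    · have h : w ^ (m + m) = (w ^ m) ^ 2 := by rw [zpow_add, sq]
      rw [h] at hn
      rcases hn with hn | hn
      · exact Or.inl ⟨_, hn⟩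
      · exact Or.inr (Or.inl ⟨_, hn⟩)
    · have h : w ^ (2 * m + 1) = w * (w ^ m) ^ 2 := by
        rw [zpow_add, zpow_one, two_mul, zpow_add, sq, mul_comm]
      rw [h] at hn
      rcases hn with hn | hn
      · exact Or.inr (Or.inr (Or.inl ⟨_, hn⟩))
      · exact Or.inr (Or.inr (Or.inr ⟨_, hn⟩))
  have hsq : ∀ (τ : k →+* ℝ) (v : (𝓞 k)ˣ), 0 < (τ ((v : 𝓞 k) : k)) ^ 2 := fun τ v => by
    have : τ ((v : 𝓞 k) : k) ≠ 0 := by simp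
    positivity
  have hw12 : τ₁ ((w : 𝓞 k) : k) * τ₂ ((w : 𝓞 k) : k) < 0 := by
    rcases hsign ε with ⟨v, rfl⟩ | ⟨v, rfl⟩ | ⟨v, rfl⟩ | ⟨v, rfl⟩ <;>
    have hv₁ := hsq τ₁ v <;> have hv₂ := hsq τ₂ v <;>
    simp only [Units.val_pow_eq_pow_val, Units.val_mul, Units.val_neg,
      RingOfIntegers.coe_eq_algebraMap, map_pow, map_mul, map_neg] at hε₁ hε₂ hv₁ hv₂ ⊢
    · linarith
    · linarith
    · exact mul_neg_of_pos_of_neg (pos_of_mul_pos_left hε₁ hv₁.le) (by nlinarith)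
    · exact mul_neg_of_neg_of_pos (by nlinarith) (by nlinarith)
  rcases hsign u with ⟨v, rfl⟩ | ⟨v, rfl⟩ | ⟨v, rfl⟩ | ⟨v, rfl⟩ <;>
    have hv₁ := hsq τ₁ v <;> have hv₂ := hsq τ₂ v <;>
    simp only [Units.val_pow_eq_pow_val, Units.val_mul, Units.val_neg,
      RingOfIntegers.coe_eq_algebraMap, map_pow, map_mul, map_neg] at hu₁ hu₂ hv₁ hv₂ hw12
  · exact ⟨v, rfl⟩
  · linarith
  · exfalso
    have h1 := pos_of_mul_pos_left hu₁ hv₁.le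
    have h2 := pos_of_mul_pos_left hu₂ hv₂.le
    nlinarith
  · exfalso
    rw [neg_pos] at hu₁ hu₂
    have h1 := neg_of_mul_neg_left hu₁ hv₁.le
    have h2 := neg_of_mul_neg_left hu₂ hv₂.le
    nlinarith

theorem eq_sq_or_eq_neg_mul_sq (h2 : Module.finrank ℚ k = 2) (τ₁ τ₂ : k →+* ℝ) {ε : (𝓞 k)ˣ}
    (hε₁ : 0 < τ₁ ((ε : 𝓞 k) : k)) (hε₂ : τ₂ ((ε : 𝓞 k) : k) < 0) {u : (𝓞 k)ˣ}
    (hu₂ : 0 < τ₂ ((u : 𝓞 k) : k)) : ∃ v : (𝓞 k)ˣ, u = v ^ 2 ∨ u = -ε * v ^ 2 := by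
  have hu0 : τ₁ ((u : 𝓞 k) : k) ≠ 0 := by simp
  rcases hu0.lt_or_gt with hu₁ | hu₁
  · obtain ⟨v, hv⟩ := eq_sq_of_totally_positive h2 τ₁ τ₂ hε₁ hε₂ (u := -ε * u)
      (by simp only [Units.val_mul, Units.val_neg,
            RingOfIntegers.coe_eq_algebraMap, map_mul, map_neg] at *; nlinarith)
      (by simp only [Units.val_mul, Units.val_neg,
            RingOfIntegers.coe_eq_algebraMap, map_mul, map_neg] at *; nlinarith)
    refine ⟨ε⁻¹ * v, Or.inr ?_⟩
    rw [mul_pow, ← hv, sq]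
    simp [mul_assoc]
  · obtain ⟨v, hv⟩ := eq_sq_of_totally_positive h2 τ₁ τ₂ hε₁ hε₂ hu₁ hu₂
    exact ⟨v, Or.inl hv⟩

end RealUnits

section RankNorm

theorem finrank_le_of_ker_divisible {A B : Type*} [AddCommGroup A] [AddCommGroup B]
    [Module.Finite ℤ A] [Module.Finite ℤ B] (f : A →ₗ[ℤ] B)
    (h : ∀ x, f x = 0 → ∃ y, f y = 0 ∧ (2 : ℤ) • x = (4 : ℤ) • y) :
    Module.finrank ℤ A ≤ Module.finrank ℤ B := by
  have htors : Module.IsTorsion ℤ (LinearMap.ker f) := by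
    let N : Submodule ℤ A := (LinearMap.ker f).map (LinearMap.lsmul ℤ A 2)
    have hN : N ≤ Ideal.span {(2 : ℤ)} • N := by
      rintro _ ⟨x, hx, rfl⟩
      obtain ⟨y, hy, hxy⟩ := h x hx
      rw [LinearMap.lsmul_apply, hxy, show (4 : ℤ) = 2 * 2 by norm_num, mul_smul]
      exact Submodule.smul_mem_smul (Ideal.mem_span_singleton_self 2) ⟨y, hy, rfl⟩
    obtain ⟨r, hr, hrN⟩ := Submodule.exists_sub_one_mem_and_smul_eq_zero_of_fg_of_le_smul _ N
      (IsNoetherian.noetherian N) hN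
    rw [Ideal.mem_span_singleton] at hr
    rintro ⟨x, hx⟩
    refine ⟨⟨r * 2, mem_nonZeroDivisors_of_ne_zero (by omega)⟩, Subtype.ext ?_⟩
    have := hrN _ ⟨x, hx, rfl⟩
    rwa [LinearMap.lsmul_apply, ← mul_smul] at this
  have h0 := Module.finrank_eq_zero_iff_isTorsion.2 htors
  have h1 := (LinearMap.ker f).finrank_quotient_add_finrank
  rw [h0, add_zero, f.quotKerEquivRange.finrank_eq] at h1
  rw [← h1]
  exact Submodule.finrank_le _

variable {k K : Type} [Field k] [NumberField k] [Field K] [NumberField K] [Algebra k K]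

theorem rank_le_of_norm_one_sq (h : ∀ η : (𝓞 K)ˣ, Algebra.norm k ((η : 𝓞 K) : K) = 1 →
    ∃ ξ : (𝓞 K)ˣ, Algebra.norm k ((ξ : 𝓞 K) : K) = 1 ∧ (η = ξ ^ 2 ∨ η = -ξ ^ 2)) :
    Units.rank K ≤ Units.rank k := by
  rw [← Units.finrank_eq, ← Units.finrank_eq]
  let f := (MonoidHom.toAdditive (Units.map (RingOfIntegers.norm k (L := K)))).toIntLinearMap
  have hf : ∀ η : (𝓞 K)ˣ, f (Additive.ofMul η) = 0 ↔ Algebra.norm k ((η : 𝓞 K) : K) = 1 := by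
    intro η
    change Units.map (RingOfIntegers.norm k) η = 1 ↔ _
    rw [Units.ext_iff, RingOfIntegers.ext_iff]
    simp
  refine finrank_le_of_ker_divisible f fun x hx => ?_
  obtain ⟨ξ, hξ, h2⟩ := h x.toMul ((hf x.toMul).1 hx)
  refine ⟨Additive.ofMul ξ, (hf ξ).2 hξ, ?_⟩
  apply Additive.toMul.injective
  rw [toMul_zsmul, toMul_zsmul, toMul_ofMul]
  norm_cast
  rcases h2 with h2 | h2 <;> rw [h2]
  · rw [← pow_mul]
  · rw [neg_sq, ← pow_mul]

end RankNorm

section SqrtUnit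

variable {k K : Type} [Field k] [NumberField k] [Field K] [NumberField K] [Algebra k K]

theorem coe_units_mul {F : Type*} [Field F] (a b : (𝓞 F)ˣ) :
    (((a * b : (𝓞 F)ˣ) : 𝓞 F) : F) = ((a : 𝓞 F) : F) * ((b : 𝓞 F) : F) := rfl

theorem coe_units_neg {F : Type*} [Field F] (a : (𝓞 F)ˣ) :
    (((-a : (𝓞 F)ˣ) : 𝓞 F) : F) = -((a : 𝓞 F) : F) := rfl

theorem coe_units_pow {F : Type*} [Field F] (a : (𝓞 F)ˣ) (n : ℕ) :
    (((a ^ n : (𝓞 F)ˣ) : 𝓞 F) : F) = ((a : 𝓞 F) : F) ^ n := by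
  push_cast
  rfl

theorem exists_norm_eq_of_pos (h2 : Module.finrank ℚ k = 2) (hK : Module.finrank k K = 2)
    (τ₁ τ₂ : k →+* ℝ) {ε : (𝓞 k)ˣ}
    (hε₁ : 0 < τ₁ ((ε : 𝓞 k) : k)) (hε₂ : τ₂ ((ε : 𝓞 k) : k) < 0) (δ : (𝓞 K)ˣ)
    (hδ : ((δ : 𝓞 K) : K) ^ 2 = algebraMap k K ((ε : 𝓞 k) : k))
    (hNδ : Algebra.norm k ((δ : 𝓞 K) : K) = -((ε : 𝓞 k) : k))
    {u : (𝓞 k)ˣ} (hu₂ : 0 < τ₂ ((u : 𝓞 k) : k)) :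
    ∃ t : (𝓞 K)ˣ, Algebra.norm k ((t : 𝓞 K) : K) = ((u : 𝓞 k) : k) ∧
      (((t : 𝓞 K) : K) ^ 2 = algebraMap k K ((u : 𝓞 k) : k) ∨
        ((t : 𝓞 K) : K) ^ 2 = -algebraMap k K ((u : 𝓞 k) : k)) := by
  obtain ⟨v, hv⟩ := eq_sq_or_eq_neg_mul_sq h2 τ₁ τ₂ hε₁ hε₂ hu₂
  obtain ⟨v', hv'⟩ : ∃ v' : (𝓞 K)ˣ, ((v' : 𝓞 K) : K) = algebraMap k K ((v : 𝓞 k) : k) :=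
    ⟨Units.map (algebraMap (𝓞 k) (𝓞 K)).toMonoidHom v, rfl⟩
  rcases hv with rfl | rfl
  · refine ⟨v', ?_, Or.inl ?_⟩
    · rw [hv', Algebra.norm_algebraMap, hK]
      push_cast
      rfl
    · rw [hv']
      push_cast
      rfl
  · refine ⟨v' * δ, ?_, Or.inr ?_⟩
    · simp only [coe_units_mul, coe_units_neg, coe_units_pow]
      rw [map_mul, hNδ, hv', Algebra.norm_algebraMap, hK]
      ring
    · simp only [coe_units_mul, coe_units_neg, coe_units_pow, map_mul, map_neg, map_pow]
      rw [mul_pow, hδ, hv']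
      ring

omit [NumberField K] in
theorem exists_unit_of_sq_eq_unit_mul {y : K} {η : (𝓞 K)ˣ} (h : y ^ 2 = ((η : 𝓞 K) : K)) :
    ∃ v : (𝓞 K)ˣ, ((v : 𝓞 K) : K) = y := by
  have hInt : IsIntegral ℤ y := by
    refine IsIntegral.of_pow (n := 2) (by norm_num) ?_
    rw [h]
    exact RingOfIntegers.isIntegral_coe _
  let z : 𝓞 K := ⟨y, hInt⟩
  have hz : z ^ 2 = η := RingOfIntegers.ext (by push_cast; exact h)
  have hu : IsUnit z := (isUnit_pow_iff two_ne_zero).1 (hz ▸ η.isUnit)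
  exact ⟨hu.unit, rfl⟩

theorem exists_isUnitMulSq_of_not_isUnitMulSq [IsGalois k K] {σ : Gal(K/k)}
    (hσ : ∀ τ : Gal(K/k), τ = 1 ∨ τ = σ) (hσ1 : σ ≠ 1)
    (h2 : Module.finrank ℚ k = 2) (hK : Module.finrank k K = 2)
    (τ₁ τ₂ : k →+* ℝ) (φ : K →+* ℝ) {ε : (𝓞 k)ˣ}
    (hε₁ : 0 < τ₁ ((ε : 𝓞 k) : k)) (hε₂ : τ₂ ((ε : 𝓞 k) : k) < 0) (δ : (𝓞 K)ˣ)
    (hδ : ((δ : 𝓞 K) : K) ^ 2 = algebraMap k K ((ε : 𝓞 k) : k))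
    (hNδ : Algebra.norm k ((δ : 𝓞 K) : K) = -((ε : 𝓞 k) : k))
    (hpos : ∀ x : K, x ≠ 0 → 0 < τ₂ (Algebra.norm k x)) :
    ∃ m : 𝓞 k, ¬ IsUnitMulSq k (m : k) ∧ IsUnitMulSq K (algebraMap k K (m : k)) := by
  by_contra! hcon
  have h4 : Module.finrank ℚ K = 4 := by
    rw [← Module.finrank_mul_finrank ℚ k K, h2, hK]
  suffices Units.rank K ≤ Units.rank k by
    have h1 := two_le_rank_of_finrank_eq_four h4 φ
    have h3 := rank_le_one_of_finrank_eq_two h2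
    omega
  refine rank_le_of_norm_one_sq fun η hη => ?_
  obtain ⟨b, hb, hηb⟩ := exists_integer_of_norm_eq_one hσ hσ1 hη
  have : Module.Finite (𝓞 k) (𝓞 K) := IsIntegralClosure.finite (𝓞 k) k K (𝓞 K)
  have hm : ((RingOfIntegers.norm k b : 𝓞 k) : k) = Algebra.norm k (b : K) := rfl
  have hη0 : ((η : 𝓞 K) : K) ≠ 0 := by simp
  have hb0 : (b : K) ≠ 0 := by simpa using hb
  obtain ⟨u, y, huy⟩ : IsUnitMulSq k (RingOfIntegers.norm k b : k) := by
    by_contra h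
    refine hcon _ h ⟨η⁻¹, (b : K), ?_⟩
    rw [hm, ← hηb, ← mul_assoc, RingOfIntegers.coe_eq_algebraMap, RingOfIntegers.coe_eq_algebraMap,
      ← map_mul, Units.inv_mul, map_one, one_mul]
  rw [hm] at huy
  have hy0 : y ≠ 0 := by
    rintro rfl
    exact hb0 (Algebra.norm_eq_zero_iff.1 (huy.trans (by simp)))
  have hyK : algebraMap k K y ≠ 0 := by simpa using hy0
  obtain ⟨u', hu'⟩ : ∃ u' : (𝓞 K)ˣ, ((u' : 𝓞 K) : K) = algebraMap k K ((u : 𝓞 k) : k) :=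
    ⟨Units.map (algebraMap (𝓞 k) (𝓞 K)).toMonoidHom u, rfl⟩
  have hvsq : ((b : K) / algebraMap k K y) ^ 2 = (((η * u' : (𝓞 K)ˣ) : 𝓞 K) : K) := by
    rw [div_pow, ← hηb, huy, map_mul, map_pow]
    rw [coe_units_mul, hu']
    field_simp
  obtain ⟨v, hv⟩ := exists_unit_of_sq_eq_unit_mul hvsq
  rw [← hv] at hvsq
  rw [coe_units_mul] at hvsq
  have hv0 : ((v : 𝓞 K) : K) ≠ 0 := by simp
  let n : (𝓞 k)ˣ := Units.map (RingOfIntegers.norm k) v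
  have hn : ((n : 𝓞 k) : k) = Algebra.norm k ((v : 𝓞 K) : K) := rfl
  have hnu : ((n : 𝓞 k) : k) = ((u : 𝓞 k) : k) ∨ ((n : 𝓞 k) : k) = -((u : 𝓞 k) : k) := by
    rw [← sq_eq_sq_iff_eq_or_eq_neg, hn, ← map_pow, hvsq, map_mul, hη, hu',
      Algebra.norm_algebraMap, hK, one_mul]
  obtain ⟨t, ht, ht2⟩ := exists_norm_eq_of_pos h2 hK τ₁ τ₂ hε₁ hε₂ δ hδ hNδ (u := n)
    (by rw [hn]; exact hpos _ hv0)
  have ht0 : ((t : 𝓞 K) : K) ≠ 0 := by simp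
  have hξ : (((v * t⁻¹ : (𝓞 K)ˣ) : 𝓞 K) : K) * ((t : 𝓞 K) : K) = ((v : 𝓞 K) : K) := by
    have := congrArg (fun x : (𝓞 K)ˣ => ((x : 𝓞 K) : K)) (inv_mul_cancel_right v t)
    push_cast at this ⊢
    exact this
  have hξN : Algebra.norm k (((v * t⁻¹ : (𝓞 K)ˣ) : 𝓞 K) : K) = 1 := by
    have := congrArg (Algebra.norm k) hξ
    rw [map_mul, ht, hn] at this
    exact mul_right_cancel₀ (Algebra.norm_ne_zero_iff.2 hv0) (this.trans (one_mul _).symm)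
  have ht2u : ((t : 𝓞 K) : K) ^ 2 = ((u' : 𝓞 K) : K) ∨
      ((t : 𝓞 K) : K) ^ 2 = -((u' : 𝓞 K) : K) := by
    rw [hu']
    rcases hnu with h | h <;> rw [h] at ht2
    · exact ht2
    · simpa [or_comm] using ht2
  have hu'0 : ((u' : 𝓞 K) : K) ≠ 0 := by simp
  refine ⟨v * t⁻¹, hξN, ?_⟩
  have hfin := congrArg (fun x => x ^ 2) hξ
  simp only [mul_pow, hvsq] at hfin
  refine ht2u.imp (fun h => ?_) fun h => ?_
  · rw [h] at hfin
    refine Units.ext (RingOfIntegers.ext ?_)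
    have := mul_right_cancel₀ hu'0 hfin
    push_cast at this ⊢
    exact this.symm
  · rw [h] at hfin
    refine Units.ext (RingOfIntegers.ext ?_)
    have := mul_right_cancel₀ hu'0 ((neg_mul_comm _ _).trans hfin)
    push_cast at this ⊢
    exact this.symm

end SqrtUnit

section IntegralBasis

variable {k : Type} [Field k] [NumberField k]

theorem exists_int_of_sq_mul_prime {p : ℕ} (hp : p.Prime) {t : ℚ} {n : ℤ}
    (h : p * t ^ 2 = n) : ∃ b : ℤ, t = b := by
  have hInt : IsIntegral ℤ ((p : ℚ) * t) := by
    refine IsIntegral.of_pow (n := 2) (by norm_num) ?_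
    rw [show ((p : ℚ) * t) ^ 2 = ((p * n : ℤ) : ℚ) by push_cast; rw [← h]; ring]
    exact isIntegral_algebraMap
  obtain ⟨m, hm⟩ := IsIntegrallyClosed.isIntegral_iff.1 hInt
  have hm : (m : ℚ) = p * t := hm
  have hp0 : (p : ℚ) ≠ 0 := by exact_mod_cast hp.ne_zero
  have hmn : m ^ 2 = p * n := by
    have : (m : ℚ) ^ 2 = p * n := by rw [hm, ← h]; ring
    exact_mod_cast this
  obtain ⟨b, rfl⟩ := (Nat.prime_iff_prime_int.1 hp).dvd_of_dvd_pow ⟨n, hmn⟩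
  refine ⟨b, ?_⟩
  push_cast at hm
  exact (mul_left_cancel₀ hp0 hm).symm

theorem exists_eq_int_add_int_mul (h2 : Module.finrank ℚ k = 2) {p : ℕ} (hp : p.Prime)
    (hp2 : Odd p) {s ω : 𝓞 k} (hs : s ^ 2 = p) (hω : 2 * ω = 1 + s)
    (hs_rat : ∀ y : ℚ, algebraMap ℚ k y ≠ s) (x : 𝓞 k) : ∃ a b : ℤ, x = a + b * ω := by
  obtain ⟨hG, σ, hσ, hσ1⟩ := exists_generator_of_finrank_eq_two h2
  have hsk : (s : k) ^ 2 = algebraMap ℚ k (p : ℚ) := by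
    have := congrArg (fun x : 𝓞 k => (x : k)) hs
    simpa [map_ofNat] using this
  have hσs := apply_sqrt_eq_neg hσ hsk hs_rat
  obtain ⟨r, t, hx, hN⟩ := exists_norm_eq_sq_sub hσ hσ1 hsk hs_rat (x : k)
  rw [← Algebra.coe_norm_int] at hN
  set N := Algebra.norm ℤ x
  obtain ⟨A, hA⟩ : ∃ A : ℤ, (A : ℚ) = 2 * r := by
    refine IsIntegrallyClosed.isIntegral_iff.1 ?_
    rw [← isIntegral_algebraMap_iff (algebraMap ℚ k).injective]
    have : algebraMap ℚ k (2 * r) = (x : k) + ((σ • x : 𝓞 k) : k) := by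
      change _ = (x : k) + σ (x : k)
      rw [hx, map_add σ, map_mul σ, hσs, AlgEquiv.commutes, AlgEquiv.commutes, map_mul, map_ofNat]
      ring
    rw [this]
    exact (RingOfIntegers.isIntegral_coe _).add (RingOfIntegers.isIntegral_coe _)
  obtain ⟨B, hB⟩ : ∃ B : ℤ, 2 * t = B := by
    refine exists_int_of_sq_mul_prime hp (n := A ^ 2 - 4 * N) ?_
    push_cast
    rw [hA, hN]
    ring
  have hAB : A ^ 2 - p * B ^ 2 = 4 * N := by
    have : (A : ℚ) ^ 2 - p * (B : ℚ) ^ 2 = 4 * N := by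
      rw [hA, ← hB, hN]
      ring
    exact_mod_cast this
  have hpar : Even (A - B) := by
    have h4 : Even (A ^ 2 - p * B ^ 2) := ⟨2 * N, by rw [hAB]; ring⟩
    have hpo : ¬ Even (p : ℤ) := by
      rw [Int.not_even_iff_odd]
      exact_mod_cast hp2
    simp only [Int.even_sub, Int.even_mul, hpo, Int.even_pow, false_or, ne_eq, two_ne_zero,
      not_false_eq_true, and_true] at h4 ⊢
    exact h4
  obtain ⟨a, ha⟩ := hpar
  refine ⟨a, B, RingOfIntegers.ext (mul_left_cancel₀ (two_ne_zero (α := k)) ?_)⟩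
  have hωk : 2 * (ω : k) = 1 + (s : k) := by
    have := congrArg (fun x : 𝓞 k => (x : k)) hω
    simpa [map_ofNat] using this
  have e1 : (2 : k) * algebraMap ℚ k r = A := by
    have := congrArg (algebraMap ℚ k) hA
    simpa using this.symm
  have e2 : (2 : k) * algebraMap ℚ k t = B := by
    have := congrArg (algebraMap ℚ k) hB
    simpa [map_ofNat] using this
  have e3 : (A : k) - B = a + a := by exact_mod_cast congrArg (Int.cast : ℤ → k) ha
  have e4 : (((a : 𝓞 k) + (B : 𝓞 k) * ω : 𝓞 k) : k) = a + B * (ω : k) := by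
    simp [RingOfIntegers.coe_eq_algebraMap]
  rw [e4, hx]
  linear_combination e1 + (s : k) * e2 - B * hωk + e3

end IntegralBasis

section Ramification

variable {k K : Type} [Field k] [NumberField k] [Field K] [NumberField K] [Algebra k K]

theorem isIntegral_of_monic_quadratic {R A : Type*} [CommRing R] [Ring A] [Algebra R A] {θ : A}
    {β γ : R} (h : θ ^ 2 - algebraMap R A β * θ + algebraMap R A γ = 0) : IsIntegral R θ := by
  nontriviality R
  exact ⟨.X ^ 2 - .C β * .X + .C γ, by monicity!, by simpa using h⟩

theorem exists_two_mul_eq {w δ : 𝓞 K} {q c b : ℤ} (hw : w ^ 2 - w = 2 * q)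
    (hδ : δ ^ 2 = 1 + 4 * c + 2 * b * w) : ∃ θ : 𝓞 K, 2 * θ = (w - 1) * (1 + δ) := by
  have hInt : IsIntegral (𝓞 K) (((w : K) - 1) * (1 + (δ : K)) / 2) := by
    have hw' : (w : K) ^ 2 - w = 2 * q := by
      have := congrArg (fun x : 𝓞 K => (x : K)) hw
      simpa [map_ofNat] using this
    have hδ' : (δ : K) ^ 2 = 1 + 4 * c + 2 * b * w := by
      have := congrArg (fun x : 𝓞 K => (x : K)) hδ
      simpa [map_ofNat] using this
    refine isIntegral_of_monic_quadratic (β := w - 1) (γ := -c * (w - 1) ^ 2 - b * q * (w - 1)) ?_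
    simp only [map_sub, map_mul, map_neg, map_one, map_pow, map_intCast]
    linear_combination ((w : K) - 1) ^ 2 / 4 * hδ' + ((w : K) - 1) * b / 2 * hw'
  obtain ⟨θ, hθ⟩ : ∃ θ : 𝓞 K, (θ : K) = ((w : K) - 1) * (1 + (δ : K)) / 2 :=
    ⟨⟨_, isIntegral_trans _ hInt⟩, rfl⟩
  refine ⟨θ, RingOfIntegers.ext ?_⟩
  have : 2 * (θ : K) = ((w : K) - 1) * (1 + (δ : K)) := by
    rw [hθ]
    field_simp
  simpa [map_ofNat] using this

theorem under_eq_span_of_ramified {σ : Gal(K/k)} {ω : 𝓞 k} {q : ℤ} (hω : ω ^ 2 - ω = 2 * q)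
    (hbasis : ∀ x : 𝓞 k, ∃ a b : ℤ, x = a + b * ω) {ε : 𝓞 k} {c b : ℤ}
    (hε : ε = 1 + 4 * c + 2 * b * ω) {δ : (𝓞 K)ˣ}
    (hδ : (δ : 𝓞 K) ^ 2 = algebraMap (𝓞 k) (𝓞 K) ε) (hσδ : σ • (δ : 𝓞 K) = -δ)
    {Q : Ideal (𝓞 K)} (hQ : Q.IsPrime) (hQσ : ∀ x : 𝓞 K, σ • x - x ∈ Q) :
    Q.under (𝓞 k) = Ideal.span {2, ω - 1} := by
  set w := algebraMap (𝓞 k) (𝓞 K) ω with hw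
  have hw2 : w ^ 2 - w = 2 * q := by
    have := congrArg (algebraMap (𝓞 k) (𝓞 K)) hω
    simpa [map_ofNat] using this
  obtain ⟨θ, hθ⟩ := exists_two_mul_eq (δ := δ) (c := c) (b := b) hw2
    (by rw [hδ, hε]; simp [hw, map_ofNat])
  have hσw : σ • w = w := by
    apply RingOfIntegers.ext
    exact σ.commutes (ω : k)
  have hσ2 : σ • (2 : 𝓞 K) = 2 := by
    rw [← one_add_one_eq_two, smul_add, smul_one]
  have h2Q : (2 : 𝓞 K) ∈ Q := by
    have := hQσ δ
    rw [hσδ, show -(δ : 𝓞 K) - δ = -(2 * δ) by ring, neg_mem_iff] at this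
    exact (hQ.mem_or_mem this).resolve_right fun h => hQ.ne_top (Ideal.eq_top_of_isUnit_mem _ h
      δ.isUnit)
  have hwQ : w - 1 ∈ Q := by
    have hθσ : σ • θ - θ = -((w - 1) * δ) := by
      apply mul_left_cancel₀ (two_ne_zero (α := 𝓞 K))
      have := congrArg (fun x => σ • x) hθ
      simp only [smul_mul', smul_add, smul_sub, smul_one, hσδ, hσw, hσ2] at this
      linear_combination this - hθ
    have := hQσ θ
    rw [hθσ, neg_mem_iff] at this
    exact (hQ.mem_or_mem this).resolve_right fun h => hQ.ne_top (Ideal.eq_top_of_isUnit_mem _ h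
      δ.isUnit)
  have h2q : (2 : 𝓞 k) ∈ Q.under (𝓞 k) := by
    rw [Ideal.mem_comap, map_ofNat]
    exact h2Q
  have hωq : ω - 1 ∈ Q.under (𝓞 k) := by
    rw [Ideal.mem_comap, map_sub, map_one]
    exact hwQ
  have hqp : (Q.under (𝓞 k)).IsPrime := inferInstance
  apply le_antisymm
  · intro x hx
    obtain ⟨a, b, rfl⟩ := hbasis x
    rcases Int.even_or_odd' (a + b) with ⟨n, hn | hn⟩
    · have e : (a : 𝓞 k) + b * ω = n * 2 + b * (ω - 1) := by
        have : (a : 𝓞 k) + b = 2 * n := by exact_mod_cast congrArg (Int.cast : ℤ → 𝓞 k) hn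
        linear_combination this
      rw [e]
      exact Ideal.mem_span_pair.2 ⟨_, _, rfl⟩
    · refine absurd ((Ideal.eq_top_iff_one _).2 ?_) hqp.ne_top
      have e : (1 : 𝓞 k) = (a + b * ω) - (n * 2 + b * (ω - 1)) := by
        have : (a : 𝓞 k) + b = 2 * n + 1 := by exact_mod_cast congrArg (Int.cast : ℤ → 𝓞 k) hn
        linear_combination -this
      rw [e]
      exact sub_mem hx (add_mem (Ideal.mul_mem_left _ _ h2q) (Ideal.mul_mem_left _ _ hωq))
  · rw [Ideal.span_le]
    rintro x (rfl | rfl)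
    · exact h2q
    · exact hωq

end Ramification

section SqrtUnitClassNumber

/-- An element of norm `-1` of `ℤ[ω]`, where `ω ^ 2 - ω = 2 * q`, is congruent to `1` modulo `4`
up to an even multiple of `ω` or of its conjugate `1 - ω`. -/
theorem exists_eq_one_add_of_norm_eq_neg_one {R : Type*} [CommRing R] [CharZero R] [IsDomain R]
    {q a b : ℤ} {ω : R} (hω : ω ^ 2 - ω = 2 * q)
    (h : (a + b * ω) * (a + b * (1 - ω)) = -1) :
    ∃ c b' : ℤ, (a + b * ω = 1 + 4 * c + 2 * b' * ω) ∨
      (a + b * ω = 1 + 4 * c + 2 * b' * (1 - ω)) := by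
  have hZ : a * (a + b) = 2 * (q * b ^ 2) - 1 := by
    have : (a : R) * (a + b) = 2 * (q * b ^ 2) - 1 := by
      linear_combination h + b ^ 2 * hω
    exact_mod_cast this
  have hodd : Odd (a * (a + b)) := ⟨q * b ^ 2 - 1, by rw [hZ]; ring⟩
  obtain ⟨ha, hab⟩ := Int.odd_mul.1 hodd
  obtain ⟨d, rfl⟩ : Even b := by
    have := hab.sub_odd ha
    rwa [add_sub_cancel_left] at this
  have h4 : a * (a + (d + d)) = 8 * (q * d ^ 2) - 1 := by rw [hZ]; ring
  obtain ⟨e, rfl⟩ := ha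
  rcases Int.even_or_odd' e with ⟨n, rfl | rfl⟩
  · refine ⟨n, d, Or.inl ?_⟩
    push_cast
    ring
  · have hd : ∃ m, 2 * (2 * n + 1) + 1 + (d + d) = 1 + 4 * m := by
      rcases Int.even_or_odd' d with ⟨m, rfl | rfl⟩
      · exfalso
        have : (4 * n + 3) * (4 * n + 3 + 4 * m) = 8 * (q * (2 * m) ^ 2) - 1 := by
          rw [← h4]; ring
        have h8 : 10 + 24 * n + 16 * (n ^ 2) + 12 * m + 16 * (n * m) = 32 * (q * m ^ 2) := by
          linarith
        generalize n ^ 2 = A, n * m = B, q * m ^ 2 = C at h8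
        omega
      · exact ⟨n + m + 1, by ring⟩
    obtain ⟨m, hm⟩ := hd
    refine ⟨m, -d, Or.inr ?_⟩
    have : (2 * (2 * (n : R) + 1) + 1 + (d + d)) = 1 + 4 * m := by
      exact_mod_cast congrArg (Int.cast : ℤ → R) hm
    push_cast
    linear_combination this

variable {k K : Type} [Field k] [NumberField k] [Field K] [NumberField K] [Algebra k K]

theorem exists_under_eq_of_ramified (h2 : Module.finrank ℚ k = 2) {p : ℕ} (hp : p.Prime)
    (hp8 : p % 8 = 1) {s ω : 𝓞 k} (hs : s ^ 2 = p) (hω : 2 * ω = 1 + s)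
    (hs_rat : ∀ y : ℚ, algebraMap ℚ k y ≠ s)
    {ε : (𝓞 k)ˣ} (hε : Algebra.norm ℚ ((ε : 𝓞 k) : k) = -1)
    {σ : Gal(K/k)} {δ : (𝓞 K)ˣ} (hδ : (δ : 𝓞 K) ^ 2 = algebraMap (𝓞 k) (𝓞 K) ε)
    (hσδ : σ • (δ : 𝓞 K) = -δ) :
    ∃ 𝔭 : Ideal (𝓞 k), ∀ Q : Ideal (𝓞 K), Q.IsPrime → Q ≠ ⊥ → (∀ x : 𝓞 K, σ • x - x ∈ Q) →
      Q.under (𝓞 k) = 𝔭 := by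
  obtain ⟨hG, σ', hσ', hσ1'⟩ := exists_generator_of_finrank_eq_two h2
  have hsk : (s : k) ^ 2 = algebraMap ℚ k (p : ℚ) := by
    have := congrArg (fun x : 𝓞 k => (x : k)) hs
    simpa using this
  have hωk : 2 * (ω : k) = 1 + (s : k) := by
    have := congrArg (fun x : 𝓞 k => (x : k)) hω
    simpa [map_ofNat] using this
  have hbasis := exists_eq_int_add_int_mul h2 hp (Nat.odd_iff.2 (by omega)) hs hω hs_rat
  obtain ⟨q, hq⟩ : ∃ q : ℕ, p = 8 * q + 1 := ⟨p / 8, by omega⟩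
  have hωq : ω ^ 2 - ω = 2 * (q : ℤ) := by
    apply mul_left_cancel₀ (show (4 : 𝓞 k) ≠ 0 by norm_num)
    have : (p : 𝓞 k) = 8 * q + 1 := by exact_mod_cast congrArg (Nat.cast : ℕ → 𝓞 k) hq
    push_cast
    linear_combination (2 * ω - 1 + s) * hω + hs + this
  obtain ⟨a, b, hab⟩ := hbasis ε
  have hNε : (a + b * ω) * (a + b * (1 - ω)) = -1 := by
    apply RingOfIntegers.ext
    have habk : ((ε : 𝓞 k) : k) = a + b * (ω : k) := by
      rw [hab]
      simp
    have hσω : σ' (ω : k) = 1 - ω := by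
      have h := congrArg σ' hωk
      rw [map_mul, map_add, map_ofNat, map_one, apply_sqrt_eq_neg hσ' hsk hs_rat] at h
      apply mul_left_cancel₀ (two_ne_zero (α := k))
      linear_combination h + hωk
    have hN := algebraMap_norm_eq hσ' hσ1' ((ε : 𝓞 k) : k)
    rw [hε, habk, map_add σ', map_mul σ', hσω, map_intCast, map_intCast] at hN
    have h1 : algebraMap ℚ k (-1) = -1 := by simp
    rw [h1] at hN
    simpa using hN.symm
  obtain ⟨c, b', h | h⟩ := exists_eq_one_add_of_norm_eq_neg_one hωq hNε
  · exact ⟨_, fun Q hQ _ hQσ =>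
      under_eq_span_of_ramified hωq hbasis (hab.trans h) hδ hσδ hQ hQσ⟩
  · have hωq' : (1 - ω) ^ 2 - (1 - ω) = 2 * (q : ℤ) := by linear_combination hωq
    have hbasis' : ∀ x : 𝓞 k, ∃ a b : ℤ, x = a + b * (1 - ω) := fun x => by
      obtain ⟨a, b, rfl⟩ := hbasis x
      exact ⟨a + b, -b, by push_cast; ring⟩
    exact ⟨_, fun Q hQ _ hQσ =>
      under_eq_span_of_ramified hωq' hbasis' (hab.trans h) hδ hσδ hQ hQσ⟩

theorem odd_classNumber_of_sqrt_unit (h2 : Module.finrank ℚ k = 2) (hK : Module.finrank k K = 2)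
    {p : ℕ} (hp : p.Prime) (hp8 : p % 8 = 1) {s ω : 𝓞 k} (hs : s ^ 2 = p) (hω : 2 * ω = 1 + s)
    (hs_rat : ∀ y : ℚ, algebraMap ℚ k y ≠ s) (τ₁ τ₂ : k →+* ℝ) (φ : K →+* ℝ)
    {ε : (𝓞 k)ˣ} (hε : Algebra.norm ℚ ((ε : 𝓞 k) : k) = -1)
    (hε₁ : 0 < τ₁ ((ε : 𝓞 k) : k)) (hε₂ : τ₂ ((ε : 𝓞 k) : k) < 0) {d : K}
    (hd : d ^ 2 = algebraMap k K ((ε : 𝓞 k) : k)) : Odd (classNumber K) := by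
  obtain ⟨hG, σ, hσ, hσ1⟩ := exists_generator_of_finrank_eq_two hK
  have hdk : ∀ y : k, algebraMap k K y ≠ d := by
    rintro y rfl
    have h : y ^ 2 = ((ε : 𝓞 k) : k) := (algebraMap k K).injective (by rw [map_pow, hd])
    rw [← h, map_pow] at hε₂
    exact absurd (sq_nonneg _) hε₂.not_ge
  have hσd := apply_sqrt_eq_neg hσ hd hdk
  have hNd : Algebra.norm k d = -((ε : 𝓞 k) : k) := by
    apply (algebraMap k K).injective
    rw [algebraMap_norm_eq hσ hσ1, hσd, map_neg, ← hd]
    ring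
  obtain ⟨ε', hε'⟩ : ∃ ε' : (𝓞 K)ˣ, ((ε' : 𝓞 K) : K) = algebraMap k K ((ε : 𝓞 k) : k) :=
    ⟨Units.map (algebraMap (𝓞 k) (𝓞 K)).toMonoidHom ε, rfl⟩
  obtain ⟨δ, rfl⟩ := exists_unit_of_sq_eq_unit_mul (hd.trans hε'.symm)
  have hδO : (δ : 𝓞 K) ^ 2 = algebraMap (𝓞 k) (𝓞 K) ε := by
    apply RingOfIntegers.ext
    rw [← Units.val_pow_eq_pow_val, coe_units_pow]
    exact hd
  have hσδO : σ • (δ : 𝓞 K) = -δ := RingOfIntegers.ext hσd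
  have hpos : ∀ x : K, x ≠ 0 → 0 < τ₂ (Algebra.norm k x) := by
    intro x hx
    obtain ⟨a, b, hab, hN⟩ := exists_norm_eq_sq_sub hσ hσ1 hd hdk x
    have h0 : τ₂ (Algebra.norm k x) ≠ 0 := by simpa using hx
    refine lt_of_le_of_ne ?_ h0.symm
    rw [hN, map_sub, map_mul, map_pow, map_pow]
    nlinarith [sq_nonneg (τ₂ a), mul_nonneg (neg_nonneg.2 hε₂.le) (sq_nonneg (τ₂ b))]
  obtain ⟨m, hm, hmK⟩ := exists_isUnitMulSq_of_not_isUnitMulSq hσ hσ1 h2 hK τ₁ τ₂ φ hε₁ hε₂ δ hd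
    hNd hpos
  obtain ⟨𝔭, h𝔭⟩ := exists_under_eq_of_ramified h2 hp hp8 hs hω hs_rat hε hδO hσδO
  refine odd_classNumber_of_quadratic hσ hσ1
    (odd_classNumber_quadratic h2 hp hs hω hs_rat ε hε) ?_ 𝔭 h𝔭 m hm hmK
  rintro u ⟨x, hx⟩
  have hx0 : x ≠ 0 := by
    rintro rfl
    have : ((u : 𝓞 k) : k) ≠ 0 := by simp
    exact this (hx.symm.trans (by simp))
  obtain ⟨t, ht, -⟩ := exists_norm_eq_of_pos h2 hK τ₁ τ₂ hε₁ hε₂ δ hd hNd (u := u)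
    (hx ▸ hpos x hx0)
  exact ⟨t, ht⟩

end SqrtUnitClassNumber

section SubfieldsOfComplex

theorem finrank_adjoin_sqrt {F E : Type*} [Field F] [Field E] [Algebra F E] {c : E} {D : F}
    (hc : c ^ 2 = algebraMap F E D) (hcF : ∀ y : F, algebraMap F E y ≠ c) :
    Module.finrank F F⟮c⟯ = 2 := by
  have hmonic : (Polynomial.X ^ 2 - Polynomial.C D).Monic := by monicity!
  have hroot : Polynomial.aeval c (Polynomial.X ^ 2 - Polynomial.C D) = 0 := by simp [hc]
  have hInt : IsIntegral F c := ⟨_, hmonic, by simpa [Polynomial.aeval_def] using hroot⟩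
  rw [IntermediateField.adjoin.finrank hInt]
  have h1 : (minpoly F c).natDegree ≠ 1 := by
    rw [Ne, minpoly.natDegree_eq_one_iff]
    rintro ⟨y, hy⟩
    exact hcF y hy
  have h0 := minpoly.natDegree_pos hInt
  have h2 := Polynomial.natDegree_le_of_dvd (minpoly.dvd F c hroot) hmonic.ne_zero
  rw [Polynomial.natDegree_X_pow_sub_C] at h2
  omega

theorem exists_ringHom_real {K : Type*} [Field K] (ι : K →+* ℂ) (h : ∀ x, (ι x).im = 0) :
    ∃ τ : K →+* ℝ, ∀ x, (τ x : ℂ) = ι x :=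
  ⟨{  toFun x := (ι x).re
      map_one' := by simp
      map_zero' := by simp
      map_add' x y := by simp
      map_mul' x y := by simp [h] }, fun x => Complex.ext (by simp) (by simp [h])⟩

theorem im_eq_zero_of_sq_eq_pos {c : ℂ} {r : ℝ} (hr : 0 < r) (hc : c ^ 2 = r) : c.im = 0 := by
  have hre := congrArg Complex.re hc
  have him := congrArg Complex.im hc
  rw [sq, Complex.mul_re, Complex.ofReal_re] at hre
  rw [sq, Complex.mul_im, Complex.ofReal_im] at him
  have h0 : c.re ≠ 0 := by
    intro h
    rw [h] at hre
    nlinarith [mul_self_nonneg c.im]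
  exact mul_left_cancel₀ h0 (by linarith)

theorem algebraMap_rat_ne_of_sq_eq_prime {E : Type*} [Field E] [CharZero E] {p : ℕ}
    (hp : p.Prime) {s : E} (hs : s ^ 2 = p) (y : ℚ) : algebraMap ℚ E y ≠ s := by
  rintro rfl
  have h : y * y = p := (algebraMap ℚ E).injective (by rw [← sq, map_pow, hs, map_natCast])
  exact hp.prime.irreducible.not_isSquare (Rat.isSquare_natCast_iff.1 ⟨y, h.symm⟩)

end SubfieldsOfComplex

end OddClassNumber

open OddClassNumber in
/-- **Theorem 8.**  Let `p` be a prime with `p ≡ 1 (mod 8)`, `k = ℚ(√p)` (as a subfield of `ℂ`),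
and `ε` a unit of the ring of integers of `k` which is positive in the real embedding sending
`√p` to the positive square root, with `N_{k/ℚ}(ε) = −1`.  Then `k(√ε)` has odd class number. -/
theorem classNumber_adjoin_sqrt_unit_odd
    (p : ℕ) (hp : p.Prime) (hp8 : p % 8 = 1)
    (k : IntermediateField ℚ ℂ) (hk : k = ℚ⟮(Real.sqrt p : ℂ)⟯) [NumberField k]
    (ε : (𝓞 k)ˣ)
    (hεpos : ∃ r : ℝ, 0 < r ∧ (((ε : 𝓞 k) : k) : ℂ) = r)
    (hεnorm : Algebra.norm ℚ ((ε : 𝓞 k) : k) = -1)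
    (c : ℂ) (hc : c ^ 2 = (((ε : 𝓞 k) : k) : ℂ))
    (L : IntermediateField k ℂ) (hL : L = IntermediateField.adjoin k {c}) [NumberField L] :
    Odd (NumberField.classNumber L) := by
  obtain ⟨r, hr, hεr⟩ := hεpos
  have hsqrt : (Real.sqrt p : ℂ) ^ 2 = p := by
    rw [← Complex.ofReal_pow, Real.sq_sqrt p.cast_nonneg, Complex.ofReal_natCast]
  obtain ⟨s₀, hs₀⟩ : ∃ s₀ : k, (s₀ : ℂ) = Real.sqrt p :=
    ⟨⟨Real.sqrt p, by rw [hk]; exact IntermediateField.mem_adjoin_simple_self ℚ _⟩, rfl⟩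
  have hs₀2 : s₀ ^ 2 = p := Subtype.ext (by push_cast; rw [hs₀, hsqrt])
  have hs_rat := algebraMap_rat_ne_of_sq_eq_prime hp hs₀2
  have h2 : Module.finrank ℚ k = 2 := by
    rw [hk]
    exact finrank_adjoin_sqrt (D := (p : ℚ)) (by rw [hsqrt, map_natCast])
      (algebraMap_rat_ne_of_sq_eq_prime hp hsqrt)
  obtain ⟨s, rfl⟩ : ∃ s : 𝓞 k, (s : k) = s₀ :=
    ⟨⟨s₀, IsIntegral.of_pow two_pos (hs₀2 ▸ isIntegral_natCast p)⟩, rfl⟩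
  have hs : s ^ 2 = p := RingOfIntegers.ext (by simpa using hs₀2)
  obtain ⟨ω, hω⟩ : ∃ ω : 𝓞 k, 2 * ω = 1 + s := by
    have hInt : IsIntegral ℤ ((1 + (s : k)) / 2) := by
      obtain ⟨q, hq⟩ : ∃ q : ℕ, p = 8 * q + 1 := ⟨p / 8, by omega⟩
      refine isIntegral_of_monic_quadratic (β := 1) (γ := -(2 * q)) ?_
      have : (p : k) = 8 * q + 1 := by exact_mod_cast congrArg (Nat.cast : ℕ → k) hq
      simp only [map_one, map_neg, map_mul, map_natCast, map_ofNat]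
      linear_combination (hs₀2 + this) / 4
    obtain ⟨ω, hω⟩ : ∃ ω : 𝓞 k, (ω : k) = (1 + (s : k)) / 2 := ⟨⟨_, hInt⟩, rfl⟩
    refine ⟨ω, RingOfIntegers.ext ?_⟩
    have : 2 * (ω : k) = 1 + s := by
      rw [hω]
      field_simp
    simpa [map_ofNat] using this
  obtain ⟨hG, σ, hσ, hσ1⟩ := exists_generator_of_finrank_eq_two h2
  obtain ⟨τ, hτ⟩ := exists_ringHom_real (algebraMap k ℂ) fun x => by
    obtain ⟨a, b, rfl, -⟩ := exists_norm_eq_sq_sub (D := (p : ℚ)) hσ hσ1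
      (by rw [hs₀2, map_natCast]) hs_rat x
    have hsC : algebraMap k ℂ (s : k) = Real.sqrt p := hs₀
    rw [map_add, map_mul, hsC]
    simp
  have hτε : τ ((ε : 𝓞 k) : k) = r := Complex.ofReal_injective ((hτ _).trans hεr)
  have hτ₁ : 0 < τ ((ε : 𝓞 k) : k) := hτε ▸ hr
  have hτ₂ : (τ.comp (σ : k →+* k)) ((ε : 𝓞 k) : k) < 0 := by
    have h := congrArg τ (algebraMap_norm_eq hσ hσ1 ((ε : 𝓞 k) : k))
    rw [hεnorm, map_mul, map_neg, map_one, map_neg, map_one] at h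
    exact neg_of_mul_neg_right (h.symm.trans_lt (by norm_num)) hτ₁.le
  have hck : ∀ y : k, algebraMap k ℂ y ≠ c := by
    rintro y rfl
    have h : y ^ 2 = ((ε : 𝓞 k) : k) := (algebraMap k ℂ).injective (by rw [map_pow, hc]; rfl)
    rw [← h, map_pow] at hτ₂
    exact absurd (sq_nonneg _) hτ₂.not_ge
  have hcε : c ^ 2 = algebraMap k ℂ ((ε : 𝓞 k) : k) := hc
  have hK : Module.finrank k L = 2 := by
    rw [hL]
    exact finrank_adjoin_sqrt hcε hck
  obtain ⟨d, hdc⟩ : ∃ d : L, (d : ℂ) = c :=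
    ⟨⟨c, by rw [hL]; exact IntermediateField.mem_adjoin_simple_self k c⟩, rfl⟩
  have hd : d ^ 2 = algebraMap k L ((ε : 𝓞 k) : k) := Subtype.ext (by
    push_cast
    rw [hdc]
    exact hcε)
  have hdk : ∀ y : k, algebraMap k L y ≠ d := fun y h => hck y (hdc ▸ h ▸ rfl)
  obtain ⟨hG', σ', hσ', hσ1'⟩ := exists_generator_of_finrank_eq_two hK
  obtain ⟨φ, -⟩ := exists_ringHom_real (algebraMap L ℂ) fun x => by
    obtain ⟨a, b, rfl, -⟩ := exists_norm_eq_sq_sub hσ' hσ1' hd hdk x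
    have hdC : algebraMap L ℂ d = c := hdc
    rw [map_add, map_mul, hdC, ← IsScalarTower.algebraMap_apply, ← IsScalarTower.algebraMap_apply,
      ← hτ, ← hτ]
    simp [im_eq_zero_of_sq_eq_pos hr (hc.trans hεr)]
  exact odd_classNumber_of_sqrt_unit h2 hK hp hp8 hs hω hs_rat τ _ φ hεnorm hτ₁ hτ₂ hd
end
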